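/- For all fixed integers r > k ≥ 2 and e ≥ 3, one has f_r(n, e(r-k)+k+1, e) = Ω(n^{k - 1/(e-1)} (log n)^{1/(e-1)}); that is, there exist a constant c > 0 and an integer N such that for every n ≥ N there exists a 𝒢_r(e(r-k)+k+1, e)-free r-graph on vertex set [n] with at least c · n^{k - 1/(e-1)} · (log n)^{1/(e-1)} edges. -/

import Mathlib

set_option linter.unusedSectionVars false

namespace BES

/-- indicator -/
noncomputable def ind (P : Prop) : ℝ := open Classical in if P then 1 else 0

lemma ind_nonneg (P : Prop) : 0 ≤ ind P := by unfold ind; split_ifs <;> norm_num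
lemma ind_le_one (P : Prop) : ind P ≤ 1 := by unfold ind; split_ifs <;> norm_num
lemma ind_true {P : Prop} (h : P) : ind P = 1 := by simp [ind, h]
lemma ind_false {P : Prop} (h : ¬ P) : ind P = 0 := by simp [ind, h]
lemma ind_and (P Q : Prop) : ind (P ∧ Q) = ind P * ind Q := by
  unfold ind; by_cases hP : P <;> by_cases hQ : Q <;> simp [hP, hQ]
lemma ind_not (P : Prop) : ind (¬ P) = 1 - ind P := by
  unfold ind; by_cases hP : P <;> simp [hP]
lemma ind_mono {P Q : Prop} (h : P → Q) : ind P ≤ ind Q := by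
  by_cases hP : P
  · rw [ind_true hP, ind_true (h hP)]
  · rw [ind_false hP]; exact ind_nonneg _
lemma ind_sq (P : Prop) : ind P * ind P = ind P := by
  unfold ind; split_ifs <;> norm_num
lemma ind_congr {P Q : Prop} (h : P ↔ Q) : ind P = ind Q := by rw [propext h]
lemma ind_forall {ι : Type*} (s : Finset ι) (P : ι → Prop) :
    ind (∀ i ∈ s, P i) = ∏ i ∈ s, ind (P i) := by
  by_cases h : ∀ i ∈ s, P i
  · rw [ind_true h, Finset.prod_eq_one]
    intro i hi; exact ind_true (h i hi)
  · rw [ind_false h]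
    push Not at h
    obtain ⟨i, hi, hPi⟩ := h
    exact (Finset.prod_eq_zero hi (ind_false hPi)).symm
lemma ind_exists_le {ι : Type*} (s : Finset ι) (P : ι → Prop) :
    ind (∃ i ∈ s, P i) ≤ ∑ i ∈ s, ind (P i) := by
  by_cases h : ∃ i ∈ s, P i
  · obtain ⟨i, hi, hPi⟩ := h
    calc ind (∃ i ∈ s, P i) ≤ 1 := ind_le_one _
      _ = ind (P i) := (ind_true hPi).symm
      _ ≤ _ := Finset.single_le_sum (f := fun i => ind (P i)) (fun j _ => ind_nonneg _) hi
  · rw [ind_false h]; exact Finset.sum_nonneg (fun j _ => ind_nonneg _)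
lemma card_filter_ind {ι : Type*} (s : Finset ι) (P : ι → Prop) [DecidablePred P] :
    ((s.filter P).card : ℝ) = ∑ i ∈ s, ind (P i) := by
  rw [Finset.card_filter]
  push_cast
  apply Finset.sum_congr rfl
  intro i _
  unfold ind
  by_cases h : P i <;> simp [h]

section prob
variable {Ω : Type*} [Fintype Ω] [DecidableEq Ω]

/-- product weight of a subset -/
noncomputable def wt (p : Ω → ℝ) (X : Finset Ω) : ℝ := ∏ i, if i ∈ X then p i else 1 - p i

/-- expectation over a random subset -/
noncomputable def EE (p : Ω → ℝ) (f : Finset Ω → ℝ) : ℝ := ∑ X : Finset Ω, wt p X * f X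

lemma sum_prod_ite (a b : Ω → ℝ) :
    ∑ X : Finset Ω, ∏ i, (if i ∈ X then a i else b i) = ∏ i, (a i + b i) := by
  rw [Finset.prod_add, ← Finset.powerset_univ]
  apply Finset.sum_congr rfl
  intro X _
  rw [Finset.prod_ite]
  congr 1
  · apply Finset.prod_congr _ (fun _ _ => rfl); ext; simp
  · apply Finset.prod_congr _ (fun _ _ => rfl); ext; simp

lemma sum_wt (p : Ω → ℝ) : ∑ X : Finset Ω, wt p X = 1 := by
  unfold wt; rw [sum_prod_ite]; simp

lemma wt_nonneg {p : Ω → ℝ} (h0 : ∀ i, 0 ≤ p i) (h1 : ∀ i, p i ≤ 1) (X : Finset Ω) :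
    0 ≤ wt p X := by
  apply Finset.prod_nonneg
  intro i _
  split_ifs
  · exact h0 i
  · linarith [h1 i]

lemma EE_const (p : Ω → ℝ) (c : ℝ) : EE p (fun _ => c) = c := by
  unfold EE; rw [← Finset.sum_mul, sum_wt, one_mul]

lemma EE_add (p : Ω → ℝ) (f g : Finset Ω → ℝ) :
    EE p (fun X => f X + g X) = EE p f + EE p g := by
  unfold EE; rw [← Finset.sum_add_distrib]; apply Finset.sum_congr rfl; intros; ring

lemma EE_sub (p : Ω → ℝ) (f g : Finset Ω → ℝ) :
    EE p (fun X => f X - g X) = EE p f - EE p g := by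
  unfold EE; rw [← Finset.sum_sub_distrib]; apply Finset.sum_congr rfl; intros; ring

lemma EE_mul_left (p : Ω → ℝ) (c : ℝ) (f : Finset Ω → ℝ) :
    EE p (fun X => c * f X) = c * EE p f := by
  unfold EE; rw [Finset.mul_sum]; apply Finset.sum_congr rfl; intros; ring

lemma EE_sum (p : Ω → ℝ) {ι : Type*} (s : Finset ι) (f : ι → Finset Ω → ℝ) :
    EE p (fun X => ∑ i ∈ s, f i X) = ∑ i ∈ s, EE p (f i) := by
  unfold EE; rw [Finset.sum_comm]; apply Finset.sum_congr rfl; intros; rw [Finset.mul_sum]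

lemma EE_mono {p : Ω → ℝ} (h0 : ∀ i, 0 ≤ p i) (h1 : ∀ i, p i ≤ 1) {f g : Finset Ω → ℝ}
    (h : ∀ X, f X ≤ g X) : EE p f ≤ EE p g :=
  Finset.sum_le_sum fun X _ => mul_le_mul_of_nonneg_left (h X) (wt_nonneg h0 h1 X)

lemma EE_nonneg {p : Ω → ℝ} (h0 : ∀ i, 0 ≤ p i) (h1 : ∀ i, p i ≤ 1) {f : Finset Ω → ℝ}
    (h : ∀ X, 0 ≤ f X) : 0 ≤ EE p f :=
  Finset.sum_nonneg fun X _ => mul_nonneg (wt_nonneg h0 h1 X) (h X)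

lemma exists_ge_EE {p : Ω → ℝ} (h0 : ∀ i, 0 ≤ p i) (h1 : ∀ i, p i ≤ 1) (f : Finset Ω → ℝ) :
    ∃ X, EE p f ≤ f X := by
  by_contra hcon
  push Not at hcon
  have hs := sum_wt p
  have h2 : ∑ X : Finset Ω, wt p X * f X < ∑ X : Finset Ω, wt p X * EE p f := by
    apply Finset.sum_lt_sum
    · intro X _
      exact mul_le_mul_of_nonneg_left (hcon X).le (wt_nonneg h0 h1 X)
    · by_contra hc
      push Not at hc
      have : ∑ X : Finset Ω, wt p X ≤ 0 := by
        apply Finset.sum_nonpos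
        intro X hX
        have h3 := hc X hX
        by_contra h4
        push Not at h4
        have := mul_lt_mul_of_pos_left (hcon X) h4
        linarith
      linarith
  rw [← Finset.sum_mul, hs, one_mul] at h2
  exact lt_irrefl _ h2

/-- `f` depends only on the coordinates in `A`. -/
def DepOn {β : Type*} (f : Finset Ω → β) (A : Finset Ω) : Prop :=
  ∀ X Y : Finset Ω, (∀ i ∈ A, i ∈ X ↔ i ∈ Y) → f X = f Y

lemma DepOn.mono {β : Type*} {f : Finset Ω → β} {A B : Finset Ω} (h : DepOn f A) (hAB : A ⊆ B) :
    DepOn f B := fun X Y hXY => h X Y fun i hi => hXY i (hAB hi)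

lemma EE_mul_indep (p : Ω → ℝ) {f g : Finset Ω → ℝ} {A B : Finset Ω}
    (hf : DepOn f A) (hg : DepOn g B) (hAB : Disjoint A B) :
    EE p (fun X => f X * g X) = EE p f * EE p g := by
  have key : EE p f * EE p g = EE p (fun X => f X * g X) * ∑ Y : Finset Ω, wt p Y := by
    unfold EE
    rw [Finset.sum_mul_sum, Finset.sum_mul_sum, ← Finset.sum_product', ← Finset.sum_product']
    let φ : Finset Ω × Finset Ω → Finset Ω × Finset Ω := fun z =>
      ((z.1 ∩ A) ∪ (z.2 \ A), (z.2 ∩ A) ∪ (z.1 \ A))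
    have hφ : ∀ z, φ (φ z) = z := by
      rintro ⟨X, Y⟩
      simp only [φ, Prod.mk.injEq]
      constructor <;> (ext i; simp only [Finset.mem_union, Finset.mem_inter, Finset.mem_sdiff]; tauto)
    apply Finset.sum_bij' (fun z _ => φ z) (fun z _ => φ z)
    · intros; simp
    · intros; simp
    · intro z _; exact hφ z
    · intro z _; exact hφ z
    · rintro ⟨X, Y⟩ _
      have h1 : f ((X ∩ A) ∪ (Y \ A)) = f X := by
        apply hf; intro i hi; simp [hi]
      have h2 : g ((X ∩ A) ∪ (Y \ A)) = g Y := by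
        apply hg; intro i hi
        have : i ∉ A := fun h => (Finset.disjoint_left.mp hAB h hi)
        simp [this]
      have h3 : wt p X * wt p Y = wt p ((X ∩ A) ∪ (Y \ A)) * wt p ((Y ∩ A) ∪ (X \ A)) := by
        unfold wt
        rw [← Finset.prod_mul_distrib, ← Finset.prod_mul_distrib]
        apply Finset.prod_congr rfl
        intro i _
        by_cases hA : i ∈ A
        · simp [hA]
        · simp only [Finset.mem_union, Finset.mem_inter, Finset.mem_sdiff, hA, and_false,
            not_false_eq_true, and_true, false_or]
          ring
      simp only [φ, h1, h2]
      linear_combination (f X * g Y) * h3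
  rw [key, sum_wt, mul_one]

lemma DepOn.prod {ι : Type*} [DecidableEq ι] {s : Finset ι} {f : ι → Finset Ω → ℝ} {A : ι → Finset Ω}
    (h : ∀ i ∈ s, DepOn (f i) (A i)) : DepOn (fun X => ∏ i ∈ s, f i X) (s.biUnion A) := by
  intro X Y hXY
  apply Finset.prod_congr rfl
  intro i hi
  exact h i hi X Y fun j hj => hXY j (Finset.mem_biUnion.mpr ⟨i, hi, hj⟩)

lemma EE_prod_indep (p : Ω → ℝ) {ι : Type*} [DecidableEq ι] (s : Finset ι)
    (f : ι → Finset Ω → ℝ) (A : ι → Finset Ω)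
    (h : ∀ i ∈ s, DepOn (f i) (A i))
    (hd : ∀ i ∈ s, ∀ j ∈ s, i ≠ j → Disjoint (A i) (A j)) :
    EE p (fun X => ∏ i ∈ s, f i X) = ∏ i ∈ s, EE p (f i) := by
  induction s using Finset.induction_on with
  | empty => simp [EE_const]
  | insert a s ha ih =>
    have e1 : (fun X => ∏ i ∈ insert a s, f i X) = fun X => f a X * ∏ i ∈ s, f i X := by
      ext X; rw [Finset.prod_insert ha]
    rw [e1, Finset.prod_insert ha]
    rw [EE_mul_indep p (h a (Finset.mem_insert_self _ _))
      (DepOn.prod (fun i hi => h i (Finset.mem_insert_of_mem hi)))]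
    · rw [ih]
      · intro i hi; exact h i (Finset.mem_insert_of_mem hi)
      · intro i hi j hj; exact hd i (Finset.mem_insert_of_mem hi) j (Finset.mem_insert_of_mem hj)
    · rw [Finset.disjoint_biUnion_right]
      intro i hi
      apply hd a (Finset.mem_insert_self _ _) i (Finset.mem_insert_of_mem hi)
      rintro rfl; exact ha hi

lemma EE_mem (p : Ω → ℝ) (j : Ω) : EE p (fun X => ind (j ∈ X)) = p j := by
  have : EE p (fun X => ind (j ∈ X)) = ∑ X : Finset Ω, ∏ i,
      (if i ∈ X then p i else (if i = j then 0 else 1 - p i)) := by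
    unfold EE
    apply Finset.sum_congr rfl
    intro X _
    beta_reduce
    by_cases hj : j ∈ X
    · rw [ind_true hj, mul_one]
      unfold wt
      apply Finset.prod_congr rfl
      intro i _
      by_cases hi : i ∈ X
      · simp [hi]
      · have : i ≠ j := by rintro rfl; exact hi hj
        simp [hi, this]
    · rw [ind_false hj, mul_zero]
      symm
      apply Finset.prod_eq_zero (Finset.mem_univ j)
      simp [hj]
  rw [this, sum_prod_ite, Finset.prod_eq_single j]
  · simp
  · intro i _ hij; simp [hij]
  · simp

lemma depOn_mem (j : Ω) : DepOn (fun X => ind (j ∈ X)) {j} := by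
  intro X Y h; exact ind_congr (h j (by simp))

lemma EE_subset (p : Ω → ℝ) (T : Finset Ω) :
    EE p (fun X => ind (∀ i ∈ T, i ∈ X)) = ∏ i ∈ T, p i := by
  simp_rw [ind_forall]
  rw [EE_prod_indep p T (fun i X => ind (i ∈ X)) (fun i => {i})]
  · simp_rw [EE_mem]
  · intro i _; exact depOn_mem i
  · intro i _ j _ hij; simpa using hij

/-- Chebyshev for a sum of pairwise independent indicators. -/
lemma chebyshev {p : Ω → ℝ} (h0 : ∀ i, 0 ≤ p i) (h1 : ∀ i, p i ≤ 1)
    {ι : Type*} [DecidableEq ι] (s : Finset ι)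
    (Z : ι → Finset Ω → Prop) (A : ι → Finset Ω)
    (h : ∀ i ∈ s, DepOn (Z i) (A i))
    (hd : ∀ i ∈ s, ∀ j ∈ s, i ≠ j → Disjoint (A i) (A j)) {μ M : ℝ}
    (hμ : ∑ i ∈ s, EE p (fun X => ind (Z i X)) ≤ μ) (hM : μ < M) :
    EE p (fun X => ind (M < ∑ i ∈ s, ind (Z i X))) ≤ μ / (M - μ) ^ 2 := by
  set a : ι → ℝ := fun i => EE p (fun X => ind (Z i X)) with ha
  have hvar : EE p (fun X => (∑ i ∈ s, (ind (Z i X) - a i)) ^ 2) ≤ μ := by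
    have e1 : (fun X => (∑ i ∈ s, (ind (Z i X) - a i)) ^ 2) =
        fun X => ∑ i ∈ s, ∑ j ∈ s, (ind (Z i X) - a i) * (ind (Z j X) - a j) := by
      ext X; rw [sq, Finset.sum_mul_sum]
    rw [e1, EE_sum]
    refine le_trans ?_ hμ
    apply Finset.sum_le_sum
    intro i hi
    rw [EE_sum, Finset.sum_eq_single i]
    · have e2 : (fun X => (ind (Z i X) - a i) * (ind (Z i X) - a i)) =
          fun X => (1 - 2 * a i) * ind (Z i X) + a i * a i := by
        ext X; linear_combination ind_sq (Z i X)
      rw [e2, EE_add, EE_mul_left, EE_const]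
      change (1 - 2 * a i) * a i + a i * a i ≤ a i
      nlinarith [mul_self_nonneg (a i)]
    · intro j hj hji
      rw [EE_mul_indep p (A := A i) (B := A j)]
      · rw [EE_sub, EE_const]; simp [ha]
      · intro X Y hXY; simp only [h i hi X Y hXY]
      · intro X Y hXY; simp only [h j hj X Y hXY]
      · exact hd i hi j hj hji.symm
    · intro hc; exact absurd hi hc
  have hpos : 0 < (M - μ) ^ 2 := by have : 0 < M - μ := by linarith
                                    positivity
  rw [le_div_iff₀ hpos, mul_comm, ← EE_mul_left]
  refine le_trans (EE_mono h0 h1 ?_) hvar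
  intro X
  by_cases hX : M < ∑ i ∈ s, ind (Z i X)
  · rw [ind_true hX, mul_one, Finset.sum_sub_distrib]
    have : M - μ ≤ ∑ i ∈ s, ind (Z i X) - ∑ i ∈ s, a i := by linarith
    have h3 : 0 ≤ M - μ := by linarith
    exact pow_le_pow_left₀ h3 this 2
  · rw [ind_false hX, mul_zero]; positivity

end prob
end BES

set_option linter.unusedSectionVars false

namespace BES
section nib
variable {V : Type*} [Fintype V] [DecidableEq V]

/-- no Berge cycles of length 2, 3, 4 -/
structure Girth5 (E : Finset (Finset V)) : Prop where
  lin : ∀ e ∈ E, ∀ f ∈ E, e ≠ f → ∀ x y, x ∈ e → x ∈ f → y ∈ e → y ∈ f → x = y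
  tri : ∀ e ∈ E, ∀ f ∈ E, ∀ g ∈ E, e ≠ f → f ≠ g → e ≠ g → ∀ x y z,
    x ∈ e → x ∈ f → y ∈ f → y ∈ g → z ∈ g → z ∈ e → x ≠ y → y ≠ z → x ≠ z → False
  quad : ∀ e ∈ E, ∀ f ∈ E, ∀ g ∈ E, ∀ h ∈ E, e ≠ f → e ≠ g → e ≠ h → f ≠ g → f ≠ h → g ≠ h →
    ∀ x y z w, x ∈ e → x ∈ f → y ∈ f → y ∈ g → z ∈ g → z ∈ h → w ∈ h → w ∈ e →
    x ≠ y → x ≠ z → x ≠ w → y ≠ z → y ≠ w → z ≠ w → False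

/-- degree of `v` in edges of size `s+1` -/
def dg (E : Finset (Finset V)) (v : V) (s : ℕ) : ℕ :=
  (E.filter (fun e => v ∈ e ∧ e.card = s + 1)).card

/-- `u` is not closed by an edge of `G` -/
def OP (G : Finset (Finset V)) (u : V) (X : Finset (V ⊕ V)) : Prop :=
  ∀ e ∈ G.filter (fun e => u ∈ e), ¬ ∀ w ∈ (e.erase u).map Function.Embedding.inl, w ∈ X

/-- product of the opening probabilities -/
noncomputable def op (q : ℝ) (G : Finset (Finset V)) (u : V) : ℝ :=
  ∏ e ∈ G.filter (fun e => u ∈ e), (1 - q ^ (e.card - 1))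

lemma depOn_sub (T : Finset V) :
    DepOn (fun X : Finset (V ⊕ V) => ∀ w ∈ T.map Function.Embedding.inl, w ∈ X)
      (T.map Function.Embedding.inl) := by
  intro X Y h
  apply propext
  constructor
  · intro hX w hw; exact (h w hw).mp (hX w hw)
  · intro hX w hw; exact (h w hw).mpr (hX w hw)

lemma depOn_OP (G : Finset (Finset V)) (u : V) :
    DepOn (OP G u) ((G.filter (fun e => u ∈ e)).biUnion
      (fun e => (e.erase u).map Function.Embedding.inl)) := by
  intro X Y h
  unfold OP
  apply propext
  refine forall₂_congr fun e he => not_congr (Eq.to_iff ?_)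
  apply depOn_sub
  intro i hi
  exact h i (Finset.mem_biUnion.mpr ⟨e, he, hi⟩)

lemma EE_OP (q : ℝ) (c : V → ℝ) {E G : Finset (Finset V)} (hE : Girth5 E) (hG : G ⊆ E) (u : V) :
    EE (Sum.elim (fun _ : V => q) c) (fun X => ind (OP G u X)) = op q G u := by
  unfold OP op
  simp_rw [ind_forall]
  rw [EE_prod_indep _ _ _ (fun e => (e.erase u).map Function.Embedding.inl)]
  · apply Finset.prod_congr rfl
    intro e he
    simp_rw [ind_not]
    rw [EE_sub, EE_const]
    have h1 := EE_subset (Sum.elim (fun _ : V => q) c) ((e.erase u).map Function.Embedding.inl)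
    rw [h1]
    simp only [Finset.prod_map, Function.Embedding.inl_apply, Sum.elim_inl, Finset.prod_const]
    rw [Finset.card_erase_of_mem (Finset.mem_filter.mp he).2]
  · intro e he X Y h
    have h5 := depOn_sub _ X Y h
    simp only at h5
    simp only [ind_not, h5]
  · intro e he f hf hef
    rw [Finset.disjoint_left]
    intro w hw hw'
    simp only [Finset.mem_map, Finset.mem_erase, Function.Embedding.inl_apply] at hw hw'
    obtain ⟨a, ⟨ha, hae⟩, rfl⟩ := hw
    obtain ⟨b, ⟨hb, hbf⟩, hab⟩ := hw'
    obtain rfl : b = a := by simpa using hab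
    rw [Finset.mem_filter] at he hf
    exact ha (hE.lin e (hG he.1) f (hG hf.1) hef b u hae hbf he.2 hf.2)

lemma EE_mul_OP (q : ℝ) (c : V → ℝ) {E G : Finset (Finset V)} (hE : Girth5 E) (hG : G ⊆ E) (u : V)
    {f : Finset (V ⊕ V) → ℝ} (hf : DepOn f {Sum.inl u, Sum.inr u}) :
    EE (Sum.elim (fun _ : V => q) c) (fun X => f X * ind (OP G u X)) =
      EE (Sum.elim (fun _ : V => q) c) f * op q G u := by
  rw [← EE_OP q c hE hG]
  apply EE_mul_indep _ hf (B := (G.filter (fun e => u ∈ e)).biUnion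
      (fun e => (e.erase u).map Function.Embedding.inl))
  · intro X Y h; simp only [depOn_OP G u X Y h]
  · rw [Finset.disjoint_left]
    intro w hw hw'
    simp only [Finset.mem_biUnion, Finset.mem_map, Finset.mem_erase,
      Function.Embedding.inl_apply] at hw'
    obtain ⟨e, he, a, ⟨ha, hae⟩, rfl⟩ := hw'
    simp at hw
    exact ha hw

/-- influence region of `u` outside `e` -/
noncomputable def reg (E : Finset (Finset V)) (e : Finset V) (u : V) : Finset (V ⊕ V) :=
  open Classical in Finset.univ.filter (fun y => Sum.elim
    (fun x => x = u ∨ ∃ f ∈ E, f ≠ e ∧ u ∈ f ∧ x ∈ f) (fun x => x = u) y)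

lemma mem_reg_inl {E : Finset (Finset V)} {e : Finset V} {u x : V} :
    Sum.inl x ∈ reg E e u ↔ x = u ∨ ∃ f ∈ E, f ≠ e ∧ u ∈ f ∧ x ∈ f := by simp [reg]
lemma mem_reg_inr {E : Finset (Finset V)} {e : Finset V} {u x : V} :
    Sum.inr x ∈ reg E e u ↔ x = u := by simp [reg]

lemma disj1 {E : Finset (Finset V)} (hE : Girth5 E) {e : Finset V} (he : e ∈ E) {u u' : V}
    (hu : u ∈ e) (hu' : u' ∈ e) (hne : u ≠ u') : Disjoint (reg E e u) (reg E e u') := by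
  rw [Finset.disjoint_left]
  rintro (x | x) h h'
  · rw [mem_reg_inl] at h h'
    rcases h with rfl | ⟨f, hf, hfe, huf, hxf⟩
    · rcases h' with rfl | ⟨f', hf', hfe', huf', hxf'⟩
      · exact hne rfl
      · exact hne (hE.lin f' hf' e he hfe' _ _ hxf' hu huf' hu')
    · rcases h' with rfl | ⟨f', hf', hfe', huf', hxf'⟩
      · exact hne (hE.lin f hf e he hfe _ _ huf hu hxf hu')
      · by_cases hff : f = f'
        · subst hff
          exact hne (hE.lin f hf e he hfe _ _ huf hu huf' hu')
        · by_cases hxu : x = u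
          · subst hxu
            exact hne (hE.lin f' hf' e he hfe' _ _ hxf' hu huf' hu')
          by_cases hxu' : x = u'
          · subst hxu'
            exact hne (hE.lin f hf e he hfe _ _ huf hu hxf hu')
          exact hE.tri e he f hf f' hf' hfe.symm hff hfe'.symm u x u' hu huf hxf hxf' huf' hu'
            (Ne.symm hxu) hxu' hne
  · rw [mem_reg_inr] at h h'
    exact hne (h.symm.trans h')

lemma disj2 {E : Finset (Finset V)} (hE : Girth5 E) {e e' : Finset V} (he : e ∈ E) (he' : e' ∈ E)
    (hee : e ≠ e') {v u u' : V} (hv : v ∈ e) (hv' : v ∈ e') (hu : u ∈ e) (hu' : u' ∈ e')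
    (huv : u ≠ v) (huv' : u' ≠ v) : Disjoint (reg E e u) (reg E e' u') := by
  have hne : u ≠ u' := by
    rintro rfl; exact huv (hE.lin e he e' he' hee _ _ hu hu' hv hv')
  have hue' : u ∉ e' := fun h => huv (hE.lin e he e' he' hee _ _ hu h hv hv')
  have hue : u' ∉ e := fun h => huv' (hE.lin e he e' he' hee _ _ h hu' hv hv')
  rw [Finset.disjoint_left]
  rintro (x | x) h h'
  · rw [mem_reg_inl] at h h'
    have main1 : ∀ f ∈ E, f ≠ e → u ∈ f → u' ∈ f → False := by
      intro f hf hfe huf huf'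
      have hfe' : f ≠ e' := by rintro rfl; exact hue' huf
      exact hE.tri e he f hf e' he' hfe.symm hfe' hee u u' v hu huf huf' hu' hv' hv hne huv' huv
    rcases h with rfl | ⟨f, hf, hfe, huf, hxf⟩
    · rcases h' with rfl | ⟨f', hf', hfe', huf', hxf'⟩
      · exact hne rfl
      · refine main1 f' hf' ?_ hxf' huf'
        rintro rfl; exact hue huf'
    · rcases h' with rfl | ⟨f', hf', hfe', huf', hxf'⟩
      · exact main1 f hf hfe huf hxf
      · have hfe2 : f ≠ e' := by rintro rfl; exact hue' huf
        have hfe3 : f' ≠ e := by rintro rfl; exact hue huf'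
        by_cases hff : f = f'
        · subst hff
          exact main1 f hf hfe huf huf'
        · by_cases hxu : x = u
          · subst hxu
            exact main1 f' hf' hfe3 hxf' huf'
          by_cases hxu' : x = u'
          · subst hxu'
            exact main1 f hf hfe huf hxf
          by_cases hxv : x = v
          · subst hxv
            exact huv (hE.lin f hf e he hfe _ _ huf hu hxf hv)
          exact hE.quad e he f hf f' hf' e' he' hfe.symm hfe3.symm hee hff hfe2 hfe'
            u x u' v hu huf hxf hxf' huf' hu' hv' hv (Ne.symm hxu) hne huv hxu' hxv huv'
  · rw [mem_reg_inr] at h h'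
    exact hne (h.symm.trans h')

/-- survival of the set `f` inside `e \ v` -/
def SV (E : Finset (Finset V)) (e : Finset V) (v : V) (f : Finset V) (X : Finset (V ⊕ V)) : Prop :=
  ∀ u ∈ e.erase v, (u ∈ f → Sum.inr u ∈ X ∧ OP (E.erase e) u X) ∧ (u ∉ f → Sum.inl u ∈ X)

/-- one coordinate of survival -/
lemma depOn_SV1 (E : Finset (Finset V)) (e : Finset V) (f : Finset V) (u : V) :
    DepOn (fun X : Finset (V ⊕ V) =>
      (u ∈ f → Sum.inr u ∈ X ∧ OP (E.erase e) u X) ∧ (u ∉ f → Sum.inl u ∈ X)) (reg E e u) := by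
  intro X Y h
  have h1 := h (Sum.inr u) (mem_reg_inr.mpr rfl)
  have h2 := h (Sum.inl u) (mem_reg_inl.mpr (Or.inl rfl))
  have h3 : OP (E.erase e) u X = OP (E.erase e) u Y := by
    apply depOn_OP
    intro i hi
    apply h
    simp only [Finset.mem_biUnion, Finset.mem_filter, Finset.mem_map, Finset.mem_erase,
      Function.Embedding.inl_apply] at hi
    obtain ⟨g, ⟨⟨hge, hg⟩, hug⟩, a, ⟨hau, ha⟩, rfl⟩ := hi
    exact mem_reg_inl.mpr (Or.inr ⟨g, hg, hge, hug, ha⟩)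
  simp only [h1, h2, h3]

lemma depOn_SV (E : Finset (Finset V)) (e : Finset V) (v : V) (f : Finset V) :
    DepOn (SV E e v f) ((e.erase v).biUnion (reg E e)) := by
  intro X Y h
  unfold SV
  apply propext
  refine forall₂_congr fun u hu => Eq.to_iff ?_
  apply depOn_SV1
  intro i hi
  exact h i (Finset.mem_biUnion.mpr ⟨u, hu, hi⟩)

/-- some `s`-subset of `e \ v` survives -/
def ZZ (E : Finset (Finset V)) (v : V) (s : ℕ) (e : Finset V) (X : Finset (V ⊕ V)) : Prop :=
  ∃ f ∈ (e.erase v).powersetCard s, SV E e v f X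

lemma depOn_ZZ (E : Finset (Finset V)) (e : Finset V) (v : V) (s : ℕ) :
    DepOn (ZZ E v s e) ((e.erase v).biUnion (reg E e)) := by
  intro X Y h
  unfold ZZ
  apply propext
  refine exists_congr fun f => and_congr_right fun _ => Eq.to_iff ?_
  exact depOn_SV E e v f X Y h

lemma EE_SV {q p : ℝ} (hq0 : 0 < q) (hq1 : q < 1) (hp : 0 ≤ p) {c : V → ℝ}
    {E : Finset (Finset V)} (hE : Girth5 E) (hc : ∀ u, c u * op q E u = p)
    {e : Finset V} (he : e ∈ E) (he2 : 2 ≤ e.card) {v : V} (hv : v ∈ e) {f : Finset V} {s : ℕ}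
    (hf : f ∈ (e.erase v).powersetCard s) :
    EE (Sum.elim (fun _ : V => q) c) (fun X => ind (SV E e v f X)) ≤
      (p / (1 - q)) ^ s * q ^ (e.card - 1 - s) := by
  rw [Finset.mem_powersetCard] at hf
  unfold SV
  simp_rw [ind_forall]
  rw [EE_prod_indep _ _ _ (reg E e)]
  rotate_left
  · intro u hu X Y h
    simp only [depOn_SV1 E e f u X Y h]
  · intro u hu u' hu' hne
    exact disj1 hE he (Finset.mem_of_mem_erase hu) (Finset.mem_of_mem_erase hu') hne
  have h1 : ∀ u ∈ e.erase v, EE (Sum.elim (fun _ : V => q) c) (fun X => ind (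
      (u ∈ f → Sum.inr u ∈ X ∧ OP (E.erase e) u X) ∧ (u ∉ f → Sum.inl u ∈ X))) ≤
      if u ∈ f then p / (1 - q) else q := by
    intro u hu
    by_cases huf : u ∈ f
    · simp only [huf, forall_const, not_true_eq_false, IsEmpty.forall_iff, and_true, if_true]
      simp_rw [ind_and]
      rw [EE_mul_OP q c hE (Finset.erase_subset _ _), EE_mem]
      · simp only [Sum.elim_inr]
        have hue : u ∈ e := Finset.mem_of_mem_erase hu
        have hsplit : op q E u = (1 - q ^ (e.card - 1)) * op q (E.erase e) u := by
          unfold op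
          rw [← Finset.mul_prod_erase (E.filter (fun e => u ∈ e)) _
            (Finset.mem_filter.mpr ⟨he, hue⟩)]
          congr 1
          apply Finset.prod_congr _ (fun _ _ => rfl)
          ext g; simp only [Finset.mem_erase, Finset.mem_filter]; tauto
        have hqe : q ^ (e.card - 1) ≤ q := by
          apply pow_le_of_le_one hq0.le hq1.le; omega
        have hpos : 0 < 1 - q ^ (e.card - 1) := by linarith
        have hcc : c u * op q (E.erase e) u = p / (1 - q ^ (e.card - 1)) := by
          rw [eq_div_iff hpos.ne', ← hc u, hsplit]; ring
        rw [hcc]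
        apply div_le_div_of_nonneg_left hp (by linarith) (by linarith)
      · intro X Y h
        exact ind_congr (h (Sum.inr u) (by simp))
    · simp only [huf, false_imp_iff, not_false_eq_true, forall_const, true_and, if_false]
      rw [EE_mem]; simp
  have hcard : (e.erase v).card = e.card - 1 := Finset.card_erase_of_mem hv
  have hnn : ∀ u ∈ e.erase v, 0 ≤ EE (Sum.elim (fun _ : V => q) c) (fun X => ind (
      (u ∈ f → Sum.inr u ∈ X ∧ OP (E.erase e) u X) ∧ (u ∉ f → Sum.inl u ∈ X))) := by
    intro u hu
    by_cases huf : u ∈ f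
    · simp only [huf, forall_const, not_true_eq_false, IsEmpty.forall_iff, and_true]
      simp_rw [ind_and]
      rw [EE_mul_OP q c hE (Finset.erase_subset _ _), EE_mem]
      · simp only [Sum.elim_inr]
        have hop : ∀ G : Finset (Finset V), G ⊆ E → 0 ≤ op q G u := by
          intro G _
          apply Finset.prod_nonneg
          intro g _
          have := pow_le_one₀ (n := g.card - 1) hq0.le hq1.le
          linarith
        have h2 := hop E (subset_refl _)
        have h3 := hop (E.erase e) (Finset.erase_subset _ _)
        by_cases hcu : 0 ≤ c u
        · exact mul_nonneg hcu h3
        · push Not at hcu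
          have h4 := hc u
          have h5 : op q E u = 0 := by
            by_contra h6
            have h7 : 0 < op q E u := lt_of_le_of_ne h2 (Ne.symm h6)
            have := mul_neg_of_neg_of_pos hcu h7
            linarith
          have hue : u ∈ e := Finset.mem_of_mem_erase hu
          have hsplit : op q E u = (1 - q ^ (e.card - 1)) * op q (E.erase e) u := by
            unfold op
            rw [← Finset.mul_prod_erase (E.filter (fun e => u ∈ e)) _
              (Finset.mem_filter.mpr ⟨he, hue⟩)]
            congr 1
            apply Finset.prod_congr _ (fun _ _ => rfl)
            ext g; simp only [Finset.mem_erase, Finset.mem_filter]; tauto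
          have hqe : q ^ (e.card - 1) ≤ q := by
            apply pow_le_of_le_one hq0.le hq1.le; omega
          rw [hsplit] at h5
          rcases mul_eq_zero.mp h5 with h6 | h6
          · linarith
          · rw [h6, mul_zero]
      · intro X Y h
        exact ind_congr (h (Sum.inr u) (by simp))
    · simp only [huf, false_imp_iff, not_false_eq_true, forall_const, true_and]
      rw [EE_mem]; simp [hq0.le]
  refine le_trans (Finset.prod_le_prod hnn h1) (le_of_eq ?_)
  rw [Finset.prod_ite, Finset.prod_const, Finset.prod_const]
  congr 2
  · rw [← hf.2]; congr 1; ext u; simp only [Finset.mem_filter]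
    exact ⟨fun h => h.2, fun h => ⟨hf.1 h, h⟩⟩
  · rw [← hcard, ← hf.2, ← Finset.card_sdiff_of_subset hf.1]; congr 1; ext u; simp

end nib
end BES

set_option linter.unusedSectionVars false

namespace BES
section nib2
variable {V : Type*} [Fintype V] [DecidableEq V]

/-- hypergraph system with degree bounds -/
structure Sys (m : ℕ) (D : ℕ → ℝ) (U : Finset V) (E : Finset (Finset V)) : Prop where
  sub : ∀ e ∈ E, e ⊆ U
  two : ∀ e ∈ E, 2 ≤ e.card
  le : ∀ e ∈ E, e.card ≤ m + 1
  g : Girth5 E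
  deg : ∀ v, ∀ s ∈ Finset.Icc 1 m, (dg E v s : ℝ) ≤ D s

/-- there is a large independent set -/
def HasInd (E : Finset (Finset V)) (U : Finset V) (x : ℝ) : Prop :=
  ∃ I ⊆ U, (∀ e ∈ E, ¬ e ⊆ I) ∧ x ≤ I.card

lemma sum_deg {m : ℕ} {D : ℕ → ℝ} {U : Finset V} {E : Finset (Finset V)} (hS : Sys m D U E)
    (v : V) (h : ℕ → ℝ) (hh : ∀ s, 0 ≤ h s) :
    ∑ e ∈ E.filter (fun e => v ∈ e), h (e.card - 1) ≤ ∑ s ∈ Finset.Icc 1 m, D s * h s := by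
  rw [← Finset.sum_fiberwise_of_maps_to (g := fun e : Finset V => e.card - 1) (t := Finset.Icc 1 m)]
  · apply Finset.sum_le_sum
    intro s hs
    have h1 : ∑ e ∈ (E.filter (fun e => v ∈ e)).filter (fun e => e.card - 1 = s), h (e.card - 1)
        = (dg E v s : ℝ) * h s := by
      rw [Finset.sum_congr rfl (g := fun _ => h s)]
      · rw [Finset.sum_const, nsmul_eq_mul]
        congr 2
        unfold dg
        congr 1
        ext e
        simp only [Finset.mem_filter, Finset.mem_Icc] at hs ⊢
        constructor
        · rintro ⟨⟨he, hv⟩, hc⟩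
          exact ⟨he, hv, by omega⟩
        · rintro ⟨he, hv, hc⟩
          exact ⟨⟨he, hv⟩, by omega⟩
      · intro e he
        rw [(Finset.mem_filter.mp he).2]
    rw [h1]
    exact mul_le_mul_of_nonneg_right (hS.deg v s hs) (hh s)
  · intro e he
    rw [Finset.mem_filter] at he
    have h1 := hS.two e he.1
    have h2 := hS.le e he.1
    rw [Finset.mem_Icc]; omega

lemma one_sub_sum_le {ι : Type*} [DecidableEq ι] (s : Finset ι) (x : ι → ℝ) (h0 : ∀ i ∈ s, 0 ≤ x i)
    (h1 : ∀ i ∈ s, x i ≤ 1) : 1 - ∑ i ∈ s, x i ≤ ∏ i ∈ s, (1 - x i) := by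
  induction s using Finset.induction_on with
  | empty => simp
  | insert a s ha ih =>
    rw [Finset.sum_insert ha, Finset.prod_insert ha]
    have i1 := ih (fun i hi => h0 i (Finset.mem_insert_of_mem hi))
      (fun i hi => h1 i (Finset.mem_insert_of_mem hi))
    have a0 := h0 a (Finset.mem_insert_self _ _)
    have a1 := h1 a (Finset.mem_insert_self _ _)
    have s0 : 0 ≤ ∑ i ∈ s, x i :=
      Finset.sum_nonneg fun i hi => h0 i (Finset.mem_insert_of_mem hi)
    nlinarith [mul_le_mul_of_nonneg_left i1 (sub_nonneg.mpr a1), mul_nonneg a0 s0]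

theorem step {m : ℕ} {q p β F : ℝ} {D D' mu : ℕ → ℝ} {U : Finset V} {E : Finset (Finset V)}
    (hS : Sys m D U E) (hq0 : 0 < q) (hq1 : q < 1) (hp : 0 < p)
    (hsum : ∑ s ∈ Finset.Icc 1 m, D s * q ^ s ≤ 1 - p)
    (hmu : ∀ s ∈ Finset.Icc 1 m, ∑ s' ∈ Finset.Icc 1 m,
      D s' * ((s'.choose s : ℝ) * ((p / (1 - q)) ^ s * q ^ (s' - s))) ≤ mu s)
    (hD' : ∀ s ∈ Finset.Icc 1 m, mu s < D' s)
    (hβ : ∑ s ∈ Finset.Icc 1 m, mu s / (D' s - mu s) ^ 2 ≤ β) (hF : 0 ≤ F)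
    (ih : ∀ (U' : Finset V) (E' : Finset (Finset V)), Sys m D' U' E' →
      HasInd E' U' (F * U'.card)) :
    HasInd E U ((q * p + ((1 - q) * p - β) * F) * U.card) := by
  classical
  have hop : ∀ u, p ≤ op q E u := by
    intro u
    have h1 : ∀ e ∈ E.filter (fun e => u ∈ e), q ^ (e.card - 1) ≤ 1 :=
      fun e _ => pow_le_one₀ hq0.le hq1.le
    have h2 := one_sub_sum_le (E.filter (fun e => u ∈ e)) (fun e => q ^ (e.card - 1))
      (fun e _ => by positivity) h1
    have h3 := sum_deg hS u (fun s => q ^ s) (fun s => by positivity)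
    unfold op
    linarith
  set c : V → ℝ := fun u => p / op q E u with hcdef
  have hc : ∀ u, c u * op q E u = p := fun u => by
    have := lt_of_lt_of_le hp (hop u)
    simp only [hcdef]; field_simp
  have hc0 : ∀ u, 0 ≤ c u := fun u => div_nonneg hp.le (hp.le.trans (hop u))
  have hc1 : ∀ u, c u ≤ 1 := fun u => by
    have := lt_of_lt_of_le hp (hop u)
    exact (div_le_one this).mpr (hop u)
  set P : V ⊕ V → ℝ := Sum.elim (fun _ : V => q) c with hP
  have hP0 : ∀ i, 0 ≤ P i := by rintro (i | i) <;> simp [hP, hq0.le, hc0]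
  have hP1 : ∀ i, P i ≤ 1 := by rintro (i | i) <;> simp [hP, hq1.le, hc1]
  set NN : V → ℕ → Finset (V ⊕ V) → ℝ := fun v s X =>
    ∑ e ∈ E.filter (fun e => v ∈ e), ind (ZZ E v s e X) with hNN
  have hbad : ∀ v, ∀ s ∈ Finset.Icc 1 m,
      EE P (fun X => ind (D' s < NN v s X)) ≤ mu s / (D' s - mu s) ^ 2 := by
    intro v s hs
    apply chebyshev hP0 hP1 _ _ (fun e => (e.erase v).biUnion (reg E e))
    · intro e _; exact depOn_ZZ E e v s
    · intro e he e' he' hee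
      rw [Finset.mem_filter] at he he'
      rw [Finset.disjoint_biUnion_left]
      intro u hu
      rw [Finset.disjoint_biUnion_right]
      intro u' hu'
      rw [Finset.mem_erase] at hu hu'
      exact disj2 hS.g he.1 he'.1 hee he.2 he'.2 hu.2 hu'.2 hu.1 hu'.1
    · refine le_trans ?_ (hmu s hs)
      refine le_trans ?_ (sum_deg hS v
        (fun s' => (s'.choose s : ℝ) * ((p / (1 - q)) ^ s * q ^ (s' - s))) ?_)
      · apply Finset.sum_le_sum
        intro e he
        rw [Finset.mem_filter] at he
        calc EE P (fun X => ind (ZZ E v s e X))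
            ≤ EE P (fun X => ∑ f ∈ (e.erase v).powersetCard s, ind (SV E e v f X)) :=
              EE_mono hP0 hP1 fun X => ind_exists_le _ _
          _ = ∑ f ∈ (e.erase v).powersetCard s, EE P (fun X => ind (SV E e v f X)) :=
              EE_sum _ _ _
          _ ≤ ∑ f ∈ (e.erase v).powersetCard s, (p / (1 - q)) ^ s * q ^ (e.card - 1 - s) :=
              Finset.sum_le_sum fun f hf =>
                EE_SV hq0 hq1 hp.le hS.g hc he.1 (hS.two e he.1) he.2 hf
          _ = _ := by
              rw [Finset.sum_const, Finset.card_powersetCard, nsmul_eq_mul,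
                Finset.card_erase_of_mem he.2]
      · intro s'
        have : 0 ≤ p / (1 - q) := div_nonneg hp.le (by linarith)
        positivity
    · exact hD' s hs
  -- the random sets
  set W : Finset (V ⊕ V) → Finset V := fun X =>
    U.filter (fun v => Sum.inl v ∈ X ∧ OP E v X) with hW
  set U1 : Finset (V ⊕ V) → Finset V := fun X =>
    U.filter (fun v => ((Sum.inl v ∉ X ∧ Sum.inr v ∈ X) ∧ OP E v X) ∧
      ∀ s ∈ Finset.Icc 1 m, NN v s X ≤ D' s) with hU1
  have hEW : q * p * U.card ≤ EE P (fun X => ((W X).card : ℝ)) := by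
    simp only [hW, card_filter_ind]
    rw [EE_sum, mul_comm, ← nsmul_eq_mul]
    apply Finset.card_nsmul_le_sum
    intro v _
    simp_rw [ind_and]
    rw [hP, EE_mul_OP q c hS.g (subset_refl _), EE_mem]
    · simp only [Sum.elim_inl]
      exact mul_le_mul_of_nonneg_left (hop v) hq0.le
    · intro X Y h; exact ind_congr (h (Sum.inl v) (by simp))
  have hEU : ((1 - q) * p - β) * U.card ≤ EE P (fun X => ((U1 X).card : ℝ)) := by
    simp only [hU1, card_filter_ind]
    rw [EE_sum, mul_comm, ← nsmul_eq_mul]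
    apply Finset.card_nsmul_le_sum
    intro v _
    have h1 : EE P (fun X => ind ((Sum.inl v ∉ X ∧ Sum.inr v ∈ X) ∧ OP E v X)) = (1 - q) * p := by
      simp_rw [ind_and]
      rw [hP, EE_mul_OP q c hS.g (subset_refl _)]
      · rw [EE_mul_indep _ (A := {Sum.inl v}) (B := {Sum.inr v})]
        · simp_rw [ind_not]
          rw [EE_sub, EE_const, EE_mem, EE_mem]
          simp only [Sum.elim_inl, Sum.elim_inr]
          rw [mul_assoc, hc]
        · intro X Y h; exact ind_congr (not_congr (h (Sum.inl v) (by simp)))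
        · exact depOn_mem _
        · simp
      · intro X Y h
        have e1 := h (Sum.inl v) (by simp)
        have e2 := h (Sum.inr v) (by simp)
        simp only [e1, e2]
    have h2 : EE P (fun X => ind ((Sum.inl v ∉ X ∧ Sum.inr v ∈ X) ∧ OP E v X) -
        ∑ s ∈ Finset.Icc 1 m, ind (D' s < NN v s X)) ≤
        EE P (fun X => ind (((Sum.inl v ∉ X ∧ Sum.inr v ∈ X) ∧ OP E v X) ∧
          ∀ s ∈ Finset.Icc 1 m, NN v s X ≤ D' s)) := by
      apply EE_mono hP0 hP1
      intro X
      by_cases hb : ∀ s ∈ Finset.Icc 1 m, NN v s X ≤ D' s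
      · have : 0 ≤ ∑ s ∈ Finset.Icc 1 m, ind (D' s < NN v s X) :=
          Finset.sum_nonneg fun _ _ => ind_nonneg _
        have h7 := ind_and ((Sum.inl v ∉ X ∧ Sum.inr v ∈ X) ∧ OP E v X)
          (∀ s ∈ Finset.Icc 1 m, NN v s X ≤ D' s)
        rw [ind_true hb] at h7
        linarith
      · have h3 : (∃ s ∈ Finset.Icc 1 m, D' s < NN v s X) := by
          push Not at hb; exact hb
        have h4 := ind_exists_le (Finset.Icc 1 m) (fun s => D' s < NN v s X)
        rw [ind_true h3] at h4
        have h5 := ind_le_one ((Sum.inl v ∉ X ∧ Sum.inr v ∈ X) ∧ OP E v X)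
        have h6 := ind_nonneg (((Sum.inl v ∉ X ∧ Sum.inr v ∈ X) ∧ OP E v X) ∧
          ∀ s ∈ Finset.Icc 1 m, NN v s X ≤ D' s)
        linarith
    refine le_trans ?_ h2
    rw [EE_sub, h1, EE_sum]
    have := Finset.sum_le_sum (hbad v)
    linarith
  have hEtot : (q * p + ((1 - q) * p - β) * F) * U.card ≤
      EE P (fun X => ((W X).card : ℝ) + F * ((U1 X).card : ℝ)) := by
    rw [EE_add, EE_mul_left]
    have := mul_le_mul_of_nonneg_left hEU hF
    linarith
  obtain ⟨X, hX⟩ := exists_ge_EE hP0 hP1 (fun X => ((W X).card : ℝ) + F * ((U1 X).card : ℝ))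
  have hX' := hEtot.trans hX
  clear hEtot hX hEU hEW
  -- deterministic part
  set E' : Finset (Finset V) := ((E.filter (fun e => e \ U1 X ⊆ W X)).image
    (fun e => e ∩ U1 X)).filter (fun e => 2 ≤ e.card) with hE'
  have memE' : ∀ g ∈ E', ∃ e ∈ E, e \ U1 X ⊆ W X ∧ e ∩ U1 X = g ∧ 2 ≤ g.card := by
    intro g hg
    simp only [hE', Finset.mem_filter, Finset.mem_image] at hg
    obtain ⟨⟨e, ⟨he, heW⟩, heg⟩, h2⟩ := hg
    exact ⟨e, he, heW, heg, h2⟩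
  have hWsub : ∀ v ∈ W X, Sum.inl v ∈ X := fun v hv => (Finset.mem_filter.mp hv).2.1
  have hWop : ∀ v ∈ W X, OP E v X := fun v hv => (Finset.mem_filter.mp hv).2.2
  have hUm : ∀ v ∈ U1 X, v ∈ U ∧ ((Sum.inl v ∉ X ∧ Sum.inr v ∈ X) ∧ OP E v X) ∧
      ∀ s ∈ Finset.Icc 1 m, NN v s X ≤ D' s := by
    intro v hv
    simp only [hU1, Finset.mem_filter] at hv
    exact hv
  have hUop : ∀ v ∈ U1 X, OP E v X := fun v hv => (hUm v hv).2.1.2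
  have hUinr : ∀ v ∈ U1 X, Sum.inr v ∈ X := fun v hv => (hUm v hv).2.1.1.2
  have hUinl : ∀ v ∈ U1 X, Sum.inl v ∉ X := fun v hv => (hUm v hv).2.1.1.1
  have hS' : Sys m D' (U1 X) E' := by
    refine ⟨?_, ?_, ?_, ?_, ?_⟩
    · intro g hg
      obtain ⟨e, he, heW, rfl, h2⟩ := memE' g hg
      exact Finset.inter_subset_right
    · intro g hg
      obtain ⟨e, he, heW, rfl, h2⟩ := memE' g hg
      exact h2
    · intro g hg
      obtain ⟨e, he, heW, rfl, h2⟩ := memE' g hg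
      exact (Finset.card_le_card Finset.inter_subset_left).trans (hS.le e he)
    · choose! ψ hψ1 hψ2 hψ3 hψ4 using memE'
      have hin : ∀ g ∈ E', ∀ x ∈ g, x ∈ ψ g := by
        intro g hg x hx
        rw [← hψ3 g hg] at hx
        exact (Finset.mem_inter.mp hx).1
      have hinj : ∀ g ∈ E', ∀ h ∈ E', g ≠ h → ψ g ≠ ψ h := by
        intro g hg h hh hne heq
        apply hne
        rw [← hψ3 g hg, ← hψ3 h hh, heq]
      refine ⟨?_, ?_, ?_⟩
      · intro e he f hf hef x y h1 h2 h3 h4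
        exact hS.g.lin _ (hψ1 e he) _ (hψ1 f hf) (hinj e he f hf hef) x y (hin e he _ h1)
          (hin f hf _ h2) (hin e he _ h3) (hin f hf _ h4)
      · intro e he f hf g hg h1 h2 h3 x y z a1 a2 a3 a4 a5 a6
        exact hS.g.tri _ (hψ1 e he) _ (hψ1 f hf) _ (hψ1 g hg) (hinj e he f hf h1)
          (hinj f hf g hg h2) (hinj e he g hg h3) x y z (hin e he _ a1) (hin f hf _ a2)
          (hin f hf _ a3) (hin g hg _ a4) (hin g hg _ a5) (hin e he _ a6)
      · intro e he f hf g hg h hh h1 h2 h3 h4 h5 h6 x y z w a1 a2 a3 a4 a5 a6 a7 a8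
        exact hS.g.quad _ (hψ1 e he) _ (hψ1 f hf) _ (hψ1 g hg) _ (hψ1 h hh)
          (hinj e he f hf h1) (hinj e he g hg h2) (hinj e he h hh h3) (hinj f hf g hg h4)
          (hinj f hf h hh h5) (hinj g hg h hh h6) x y z w (hin e he _ a1) (hin f hf _ a2)
          (hin f hf _ a3) (hin g hg _ a4) (hin g hg _ a5) (hin h hh _ a6) (hin h hh _ a7)
          (hin e he _ a8)
    · intro v s hs
      by_cases hv : v ∈ U1 X
      · have hN := (hUm v hv).2.2 s hs
        refine le_trans ?_ hN
        simp only [hNN]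
        rw [← card_filter_ind]
        norm_cast
        unfold dg
        have hsub : E'.filter (fun e => v ∈ e ∧ e.card = s + 1) ⊆
            ((E.filter (fun e => v ∈ e)).filter (fun e => ZZ E v s e X)).image
              (fun e => e ∩ U1 X) := by
          intro g hg
          rw [Finset.mem_filter] at hg
          obtain ⟨hg, hvg, hgc⟩ := hg
          obtain ⟨e, he, heW, rfl, h2⟩ := memE' g hg
          rw [Finset.mem_image]
          refine ⟨e, ?_, rfl⟩
          have hve : v ∈ e := (Finset.mem_inter.mp hvg).1
          rw [Finset.mem_filter, Finset.mem_filter]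
          refine ⟨⟨he, hve⟩, (e ∩ U1 X).erase v, ?_, ?_⟩
          · rw [Finset.mem_powersetCard, Finset.card_erase_of_mem hvg]
            exact ⟨Finset.erase_subset_erase _ Finset.inter_subset_left, by omega⟩
          · intro u hu
            rw [Finset.mem_erase] at hu
            constructor
            · intro huf
              have huU : u ∈ U1 X := (Finset.mem_inter.mp (Finset.mem_of_mem_erase huf)).2
              refine ⟨hUinr u huU, ?_⟩
              intro g hg
              apply hUop u huU g
              rw [Finset.mem_filter] at hg ⊢
              exact ⟨Finset.mem_of_mem_erase hg.1, hg.2⟩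
            · intro huf
              apply hWsub
              apply heW
              rw [Finset.mem_sdiff]
              refine ⟨hu.2, fun h => huf ?_⟩
              rw [Finset.mem_erase, Finset.mem_inter]
              exact ⟨hu.1, hu.2, h⟩
        exact (Finset.card_le_card hsub).trans Finset.card_image_le
      · have h0 : dg E' v s = 0 := by
          unfold dg
          rw [Finset.card_eq_zero, Finset.filter_eq_empty_iff]
          rintro g hg ⟨hvg, _⟩
          obtain ⟨e, he, heW, rfl, h2⟩ := memE' g hg
          exact hv (Finset.mem_inter.mp hvg).2
        rw [h0]
        have h1 := hD' s hs
        have h2 := hmu s hs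
        have h3 : 0 ≤ ∑ s' ∈ Finset.Icc 1 m,
            D s' * ((s'.choose s : ℝ) * ((p / (1 - q)) ^ s * q ^ (s' - s))) := by
          apply Finset.sum_nonneg
          intro s' hs'
          have h4 : 0 ≤ D s' := le_trans (Nat.cast_nonneg _) (hS.deg v s' hs')
          have : 0 ≤ p / (1 - q) := div_nonneg hp.le (by linarith)
          positivity
        push_cast
        linarith
  obtain ⟨I, hIU, hI, hIc⟩ := ih _ _ hS'
  have hdisj : Disjoint (W X) I := by
    rw [Finset.disjoint_left]
    intro v hv hvI
    exact hUinl v (hIU hvI) (hWsub v hv)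
  refine ⟨W X ∪ I, ?_, ?_, ?_⟩
  · apply Finset.union_subset (Finset.filter_subset _ _)
    exact hIU.trans fun v hv => (hUm v hv).1
  · intro e he heI
    have h1 : e \ U1 X ⊆ W X := by
      intro x hx
      rw [Finset.mem_sdiff] at hx
      rcases Finset.mem_union.mp (heI hx.1) with h | h
      · exact h
      · exact absurd (hIU h) hx.2
    have h2 : e ∩ U1 X ⊆ I := by
      intro x hx
      rw [Finset.mem_inter] at hx
      rcases Finset.mem_union.mp (heI hx.1) with h | h
      · exact absurd (hWsub x h) (hUinl x hx.2)
      · exact h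
    by_cases h3 : 2 ≤ (e ∩ U1 X).card
    · apply hI (e ∩ U1 X) _ h2
      simp only [hE', Finset.mem_filter, Finset.mem_image]
      exact ⟨⟨e, ⟨he, h1⟩, rfl⟩, h3⟩
    · -- at most one vertex outside `W`
      have key : ∃ u ∈ e, OP E u X ∧ ∀ w ∈ e, w ≠ u → w ∈ W X := by
        rcases Finset.eq_empty_or_nonempty (e ∩ U1 X) with h4 | ⟨u, hu⟩
        · have hall : ∀ w ∈ e, w ∈ W X := by
            intro w hw
            apply h1
            rw [Finset.mem_sdiff]
            refine ⟨hw, fun h => ?_⟩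
            have : w ∈ e ∩ U1 X := Finset.mem_inter.mpr ⟨hw, h⟩
            rw [h4] at this
            simp at this
          have hne : e.Nonempty := by
            rw [← Finset.card_pos]; have := hS.two e he; omega
          obtain ⟨u, hu⟩ := hne
          exact ⟨u, hu, hWop u (hall u hu), fun w hw _ => hall w hw⟩
        · have hu' := Finset.mem_inter.mp hu
          refine ⟨u, hu'.1, hUop u hu'.2, ?_⟩
          intro w hw hwu
          apply h1
          rw [Finset.mem_sdiff]
          refine ⟨hw, fun h => h3 ?_⟩
          have : 1 < (e ∩ U1 X).card :=
            Finset.one_lt_card.mpr ⟨w, Finset.mem_inter.mpr ⟨hw, h⟩, u, hu, hwu⟩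
          omega
      obtain ⟨u, hu, huo, hall⟩ := key
      apply huo e (Finset.mem_filter.mpr ⟨he, hu⟩)
      intro w hw
      simp only [Finset.mem_map, Finset.mem_erase, Function.Embedding.inl_apply] at hw
      obtain ⟨a, ⟨hau, hae⟩, rfl⟩ := hw
      exact hWsub a (hall a hae hau)
  · rw [Finset.card_union_of_disjoint hdisj]
    push_cast
    linarith

end nib2
end BES

set_option linter.unusedSectionVars false

namespace BES

lemma choose_sum (m s : ℕ) (hs1 : 1 ≤ s) (hsm : s ≤ m) (y : ℝ) :
    ∑ s' ∈ Finset.Icc 1 m, ((m.choose s' : ℝ) * y ^ (m - s')) * (s'.choose s : ℝ)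
      = (m.choose s : ℝ) * (y + 1) ^ (m - s) := by
  have h1 : ∑ s' ∈ Finset.Icc 1 m, ((m.choose s' : ℝ) * y ^ (m - s')) * (s'.choose s : ℝ)
      = ∑ s' ∈ Finset.Ico s (m + 1), ((m.choose s' : ℝ) * y ^ (m - s')) * (s'.choose s : ℝ) := by
    symm
    apply Finset.sum_subset
    · intro x; simp only [Finset.mem_Icc, Finset.mem_Ico]; omega
    · intro x hx hx'
      simp only [Finset.mem_Icc, Finset.mem_Ico] at hx hx'
      rw [Nat.choose_eq_zero_of_lt (n := x) (k := s) (by omega)]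
      simp
  rw [h1, Finset.sum_Ico_eq_sum_range, add_comm y 1, add_pow, Finset.mul_sum]
  have h2 : m + 1 - s = m - s + 1 := by omega
  rw [h2]
  apply Finset.sum_congr rfl
  intro j hj
  rw [Finset.mem_range] at hj
  have h3 : (m.choose (s + j) : ℝ) * ((s + j).choose s : ℝ) =
      (m.choose s : ℝ) * ((m - s).choose j : ℝ) := by
    have := Nat.choose_mul (n := m) (k := s + j) (s := s) (by omega)
    rw [Nat.add_sub_cancel_left] at this
    exact_mod_cast this
  have h4 : m - (s + j) = m - s - j := by omega
  rw [h4, one_pow]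
  linear_combination (y ^ (m - s - j)) * h3

section
variable {V : Type*} [Fintype V] [DecidableEq V]

/-- the constant `a` -/
noncomputable def aa (m T : ℕ) : ℝ := 1 / (6 * 2 ^ m * (T : ℝ) ^ (m - 1))

/-- degree bounds at time `t` -/
noncomputable def DD (m T : ℕ) (q0 : ℝ) (t s : ℕ) : ℝ :=
  aa m T * (1 + 1 / (T : ℝ)) ^ t * ((m.choose s : ℝ) * ((t : ℝ) + 1) ^ (m - s)) / (2 ^ t * q0) ^ s

lemma aa_pos (m T : ℕ) (hT : 1 ≤ T) : 0 < aa m T := by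
  have : (0 : ℝ) < T := by exact_mod_cast hT
  unfold aa; positivity

lemma one_add_pow_le (T t : ℕ) (hT : 1 ≤ T) (ht : t ≤ T) : (1 + 1 / (T : ℝ)) ^ t ≤ 3 := by
  have hT' : (0 : ℝ) < T := by exact_mod_cast hT
  calc (1 + 1 / (T : ℝ)) ^ t ≤ (1 + 1 / (T : ℝ)) ^ T := by
        apply pow_le_pow_right₀ _ ht
        have : (0 : ℝ) ≤ 1 / T := by positivity
        linarith
    _ ≤ (Real.exp (1 / T)) ^ T := by
        apply pow_le_pow_left₀ (by positivity)
        rw [add_comm]; exact Real.add_one_le_exp _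
    _ = Real.exp 1 := by
        rw [← Real.exp_nat_mul]; congr 1; field_simp
    _ ≤ 3 := by have := Real.exp_one_lt_d9; linarith

lemma mean_aux (q B y : ℝ) (s s' : ℕ) (hq : 0 < q) (h1q : 0 < 1 - q) :
    B * y / q ^ s' * ((s'.choose s : ℝ) * ((1 / 2 / (1 - q)) ^ s * q ^ (s' - s))) =
      B / ((2 * q) ^ s * (1 - q) ^ s) * (y * (s'.choose s : ℝ)) := by
  by_cases hss : s' < s
  · rw [Nat.choose_eq_zero_of_lt hss]; simp
  · push Not at hss
    obtain ⟨j, rfl⟩ := Nat.exists_eq_add_of_le hss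
    have h1 : (1 / 2 / (1 - q)) ^ s = 1 / (2 ^ s * (1 - q) ^ s) := by
      rw [div_div, div_pow, one_pow, mul_pow]
    rw [Nat.add_sub_cancel_left, pow_add, h1, mul_pow 2 q s]
    have h2 : q ^ s ≠ 0 := by positivity
    have h3 : q ^ j ≠ 0 := by positivity
    have h4 : (1 - q) ^ s ≠ 0 := by positivity
    field_simp

set_option maxHeartbeats 2000000 in
lemma step_t {m T t : ℕ} {q0 : ℝ} (hm : 1 ≤ m) (hT : 1 ≤ T) (ht : t < T) (hq0 : 0 < q0)
    (hbig : 1000 * m * 2 ^ m * (T : ℝ) ^ (m + 2) * (2 ^ T * q0) ≤ 1)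
    (ih : ∀ (U : Finset V) (E : Finset (Finset V)), Sys m (DD m T q0 (t + 1)) U E →
      HasInd E U (2 ^ (t + 1) * q0 * ((T : ℝ) - (t + 1)) / 4 * U.card))
    (U : Finset V) (E : Finset (Finset V)) (hS : Sys m (DD m T q0 t) U E) :
    HasInd E U (2 ^ t * q0 * ((T : ℝ) - t) / 4 * U.card) := by
  have hT1 : (1 : ℝ) ≤ T := by exact_mod_cast hT
  have hT0 : (0 : ℝ) < T := by linarith
  have hm1 : (1 : ℝ) ≤ m := by exact_mod_cast hm
  have htT : (t : ℝ) + 1 ≤ T := by exact_mod_cast ht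
  set a := aa m T with ha
  have ha0 : 0 < a := aa_pos m T hT
  set q : ℝ := 2 ^ t * q0 with hq
  have hqpos : 0 < q := by positivity
  set δ : ℝ := 1 / T with hδ
  have hδ0 : 0 < δ := by positivity
  have hδ1 : δ ≤ 1 := by rw [hδ, div_le_one hT0]; exact hT1
  have hqQ : q ≤ 2 ^ T * q0 := by
    apply mul_le_mul_of_nonneg_right _ hq0.le
    exact pow_le_pow_right₀ (by norm_num) ht.le
  have hbq : 1000 * m * 2 ^ m * (T : ℝ) ^ (m + 2) * q ≤ 1 := by
    refine le_trans ?_ hbig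
    apply mul_le_mul_of_nonneg_left hqQ (by positivity)
  have h2m : (1 : ℝ) ≤ 2 ^ m := one_le_pow₀ (by norm_num)
  have hTm : (T : ℝ) ≤ T ^ (m + 2) := le_self_pow₀ hT1 (by omega)
  -- q m ≤ δ/4 etc
  have hbq2 : 1000 * (m * (T * q)) ≤ 1 := by
    refine le_trans ?_ hbq
    have : (m : ℝ) * 1 * T ≤ m * 2 ^ m * T ^ (m + 2) := by gcongr
    nlinarith
  have hmq : (m : ℝ) * q ≤ δ / 4 := by
    rw [hδ, div_div, le_div_iff₀ (by positivity)]
    nlinarith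
  have hqm : q ≤ m * q := le_mul_of_one_le_left hqpos.le hm1
  have hq4 : q ≤ 1 / 4 := by linarith
  set B : ℝ := a * (1 + δ) ^ t with hB
  have hB0 : 0 < B := by positivity
  have hB3 : B ≤ 3 * a := by
    have := one_add_pow_le T t hT ht.le
    rw [hB]; nlinarith
  have hDD : ∀ s, DD m T q0 t s = B * ((m.choose s : ℝ) * ((t : ℝ) + 1) ^ (m - s)) / q ^ s :=
    fun s => rfl
  have hDD' : ∀ s, DD m T q0 (t + 1) s =
      B * (1 + δ) * ((m.choose s : ℝ) * ((t : ℝ) + 1 + 1) ^ (m - s)) / (2 * q) ^ s := by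
    intro s
    unfold DD
    rw [hB, hq]
    push_cast
    rw [pow_succ, pow_succ]
    congr 2
    · ring
    · ring
  have hD'lb : ∀ s ∈ Finset.Icc 1 m, a / (2 * q) ≤ DD m T q0 (t + 1) s := by
    intro s hs
    rw [Finset.mem_Icc] at hs
    rw [hDD']
    have h1 : (1 : ℝ) ≤ (m.choose s : ℝ) := by
      exact_mod_cast Nat.choose_pos hs.2
    have h2 : (1 : ℝ) ≤ ((t : ℝ) + 1 + 1) ^ (m - s) := by
      apply one_le_pow₀
      have : (0 : ℝ) ≤ t := Nat.cast_nonneg t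
      linarith
    have h3 : (1 : ℝ) ≤ (1 + δ) ^ t := one_le_pow₀ (by linarith)
    have h4 : (2 * q) ^ s ≤ 2 * q := pow_le_of_le_one (by positivity) (by linarith) (by omega)
    apply div_le_div₀ (by positivity) _ (by positivity) h4
    calc a = a * 1 * 1 * (1 * 1) := by ring
      _ ≤ a * (1 + δ) ^ t * (1 + δ) * ((m.choose s : ℝ) * ((t : ℝ) + 1 + 1) ^ (m - s)) := by
        gcongr; linarith
  have hD'pos : ∀ s ∈ Finset.Icc 1 m, 0 < DD m T q0 (t + 1) s := by
    intro s hs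
    exact lt_of_lt_of_le (by positivity) (hD'lb s hs)
  set β : ℝ := m * (32 * T ^ 2 * q / a) with hβ
  have hβle : 2 * β + q ≤ 1 / (2 * T) := by
    have e1 : β = m * 32 * T ^ 2 * q * (6 * 2 ^ m * (T : ℝ) ^ (m - 1)) := by
      rw [hβ, ha]; unfold aa; field_simp
    have e2 : (T : ℝ) ^ (m + 2) = T ^ 2 * T ^ (m - 1) * T := by
      rw [← pow_add, ← pow_succ]; congr 1; omega
    rw [le_div_iff₀ (by positivity), e1]
    rw [e2] at hbq
    have : 0 ≤ (m : ℝ) * 2 ^ m * (T ^ 2 * T ^ (m - 1) * T) * q := by positivity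
    nlinarith
  have key := step (D' := DD m T q0 (t + 1)) (mu := fun s => (1 - δ / 4) * DD m T q0 (t + 1) s)
    (p := 1 / 2) (β := β) (F := 2 ^ (t + 1) * q0 * ((T : ℝ) - (t + 1)) / 4)
    hS hqpos (by linarith) (by norm_num) ?_ ?_ ?_ ?_ ?_ ih
  · obtain ⟨I, h1, h2, h3⟩ := key
    refine ⟨I, h1, h2, le_trans ?_ h3⟩
    apply mul_le_mul_of_nonneg_right _ (Nat.cast_nonneg _)
    have e1 : (2 : ℝ) ^ (t + 1) * q0 = 2 * q := by rw [hq, pow_succ]; ring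
    rw [e1]
    set x : ℝ := (T : ℝ) - (t + 1) with hx
    have hx0 : 0 ≤ x := by linarith
    have hxT : x ≤ T := by have : (0 : ℝ) ≤ t := Nat.cast_nonneg t
                           linarith
    have e2 : (T : ℝ) - t = x + 1 := by rw [hx]; ring
    rw [e2]
    have h5 : 1 / 2 * (1 - 1 / (2 * (T : ℝ))) ≤ (1 - q) * (1 / 2) - β := by linarith
    have h6 : 1 / 2 * (1 - 1 / (2 * (T : ℝ))) * (2 * q * x / 4) ≤
        ((1 - q) * (1 / 2) - β) * (2 * q * x / 4) :=
      mul_le_mul_of_nonneg_right h5 (by positivity)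
    have h7 : x / (2 * T) ≤ 1 / 2 := by
      rw [div_le_iff₀ (by positivity)]; linarith
    have h8 : 1 / 2 * (1 - 1 / (2 * (T : ℝ))) * (2 * q * x / 4) = q * x / 4 - q / 4 * (x / (2 * T)) := by
      field_simp
    have h9 : q / 4 * (x / (2 * T)) ≤ q / 4 * (1 / 2) :=
      mul_le_mul_of_nonneg_left h7 (by positivity)
    nlinarith
  · -- sum condition
    have e1 : ∀ s ∈ Finset.Icc 1 m, DD m T q0 t s * q ^ s ≤ B * T ^ (m - 1) * (m.choose s : ℝ) := by
      intro s hs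
      rw [Finset.mem_Icc] at hs
      rw [hDD, div_mul_cancel₀ _ (by positivity)]
      have : ((t : ℝ) + 1) ^ (m - s) ≤ T ^ (m - 1) := by
        calc ((t : ℝ) + 1) ^ (m - s) ≤ (T : ℝ) ^ (m - s) := pow_le_pow_left₀ (by positivity) htT _
          _ ≤ T ^ (m - 1) := pow_le_pow_right₀ hT1 (by omega)
      calc B * ((m.choose s : ℝ) * ((t : ℝ) + 1) ^ (m - s))
          ≤ B * ((m.choose s : ℝ) * T ^ (m - 1)) := by gcongr
        _ = _ := by ring
    refine le_trans (Finset.sum_le_sum e1) ?_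
    rw [← Finset.mul_sum]
    have e2 : ∑ s ∈ Finset.Icc 1 m, (m.choose s : ℝ) ≤ 2 ^ m := by
      have := Nat.sum_range_choose m
      have h3 : ∑ s ∈ Finset.Icc 1 m, m.choose s ≤ ∑ s ∈ Finset.range (m + 1), m.choose s := by
        apply Finset.sum_le_sum_of_subset
        intro x; simp only [Finset.mem_Icc, Finset.mem_range]; omega
      rw [this] at h3
      exact_mod_cast h3
    calc B * T ^ (m - 1) * ∑ s ∈ Finset.Icc 1 m, (m.choose s : ℝ)
        ≤ 3 * a * T ^ (m - 1) * 2 ^ m := by gcongr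
      _ = 1 - 1 / 2 := by rw [ha]; unfold aa; field_simp; norm_num
  · -- mean condition
    intro s hs
    have hs' := Finset.mem_Icc.mp hs
    have h1q : 0 < 1 - q := by linarith
    have e1 : ∀ s' ∈ Finset.Icc 1 m, DD m T q0 t s' *
        ((s'.choose s : ℝ) * ((1 / 2 / (1 - q)) ^ s * q ^ (s' - s))) =
        B / ((2 * q) ^ s * (1 - q) ^ s) *
          (((m.choose s' : ℝ) * ((t : ℝ) + 1) ^ (m - s')) * (s'.choose s : ℝ)) := by
      intro s' _
      rw [hDD]
      exact mean_aux q B ((m.choose s' : ℝ) * ((t : ℝ) + 1) ^ (m - s')) s s' hqpos h1q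
    have e5 := Finset.sum_congr rfl e1
    rw [← Finset.mul_sum, choose_sum m s hs'.1 hs'.2] at e5
    refine e5.trans_le ?_
    clear e5 e1
    rw [hDD']
    have h2 : 1 ≤ (1 - δ / 4) * (1 + δ) * (1 - q) ^ s := by
      have h3 : 1 - m * q ≤ (1 - q) ^ s := by
        calc 1 - m * q ≤ (1 - q) ^ m := by
              have := one_add_mul_le_pow (a := -q) (by linarith) m
              have e : (1 : ℝ) + -q = 1 - q := by ring
              rw [e] at this
              linarith
          _ ≤ (1 - q) ^ s := pow_le_pow_of_le_one h1q.le (by linarith) hs'.2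
      have h4 : 1 + δ / 2 ≤ (1 - δ / 4) * (1 + δ) := by nlinarith
      have h5 : 1 - δ / 4 ≤ (1 - q) ^ s := by linarith
      calc 1 ≤ (1 + δ / 2) * (1 - δ / 4) := by nlinarith
        _ ≤ _ := mul_le_mul h4 h5 (by linarith) (by nlinarith)
    have h3 : 0 ≤ B * ((m.choose s : ℝ) * ((t : ℝ) + 1 + 1) ^ (m - s)) / ((2 * q) ^ s * (1 - q) ^ s) := by
      positivity
    calc B / ((2 * q) ^ s * (1 - q) ^ s) * ((m.choose s : ℝ) * ((t : ℝ) + 1 + 1) ^ (m - s))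
        = B * ((m.choose s : ℝ) * ((t : ℝ) + 1 + 1) ^ (m - s)) / ((2 * q) ^ s * (1 - q) ^ s) * 1 := by
          ring
      _ ≤ B * ((m.choose s : ℝ) * ((t : ℝ) + 1 + 1) ^ (m - s)) / ((2 * q) ^ s * (1 - q) ^ s) *
          ((1 - δ / 4) * (1 + δ) * (1 - q) ^ s) := mul_le_mul_of_nonneg_left h2 h3
      _ = _ := by field_simp
  · intro s hs
    have := hD'pos s hs
    nlinarith
  · have e1 : ∀ s ∈ Finset.Icc 1 m, (1 - δ / 4) * DD m T q0 (t + 1) s /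
        (DD m T q0 (t + 1) s - (1 - δ / 4) * DD m T q0 (t + 1) s) ^ 2 ≤ 32 * T ^ 2 * q / a := by
      intro s hs
      have h1 := hD'pos s hs
      have h2 := hD'lb s hs
      set d := DD m T q0 (t + 1) s
      have e2 : d - (1 - δ / 4) * d = δ / 4 * d := by ring
      rw [e2]
      calc (1 - δ / 4) * d / (δ / 4 * d) ^ 2 ≤ 1 * d / (δ / 4 * d) ^ 2 := by
            gcongr; linarith
        _ = 16 * T ^ 2 / d := by rw [hδ]; field_simp; norm_num
        _ ≤ 16 * T ^ 2 / (a / (2 * q)) := by gcongr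
        _ = _ := by field_simp; norm_num
    refine le_trans (Finset.sum_le_sum e1) ?_
    rw [Finset.sum_const, Nat.card_Icc, nsmul_eq_mul, hβ]
    simp
  · have : 0 ≤ (T : ℝ) - (t + 1) := by linarith
    positivity

theorem iter {m T : ℕ} {q0 : ℝ} (hm : 1 ≤ m) (hT : 1 ≤ T) (hq0 : 0 < q0)
    (hbig : 1000 * m * 2 ^ m * (T : ℝ) ^ (m + 2) * (2 ^ T * q0) ≤ 1) :
    ∀ j ≤ T, ∀ (U : Finset V) (E : Finset (Finset V)), Sys m (DD m T q0 (T - j)) U E →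
      HasInd E U (2 ^ (T - j) * q0 * ((T : ℝ) - ((T - j : ℕ) : ℝ)) / 4 * U.card) := by
  intro j
  induction j with
  | zero =>
    intro _ U E hS
    refine ⟨∅, by simp, ?_, by simp⟩
    intro e he h
    have := hS.two e he
    rw [Finset.subset_empty.mp h] at this
    simp at this
  | succ j ih =>
    intro hj U E hS
    have h1 : T - j = T - (j + 1) + 1 := by omega
    apply step_t hm hT (by omega) hq0 hbig _ U E hS
    have := ih (by omega)
    rw [h1] at this
    intro U' E' hS'
    have h2 := this U' E' hS'
    push_cast at h2
    exact h2

theorem iter0 {m T : ℕ} {q0 : ℝ} (hm : 1 ≤ m) (hT : 1 ≤ T) (hq0 : 0 < q0)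
    (hbig : 1000 * m * 2 ^ m * (T : ℝ) ^ (m + 2) * (2 ^ T * q0) ≤ 1)
    (U : Finset V) (E : Finset (Finset V)) (hU : ∀ e ∈ E, e ⊆ U) (hc : ∀ e ∈ E, e.card = m + 1)
    (hg : Girth5 E) (hd : ∀ v, ((E.filter (fun e => v ∈ e)).card : ℝ) ≤ aa m T / q0 ^ m) :
    HasInd E U (q0 * T / 4 * U.card) := by
  have h := iter (V := V) hm hT hq0 hbig T le_rfl U E
  rw [Nat.sub_self] at h
  have h2 := h ?_
  · simpa using h2
  · refine ⟨hU, fun e he => by rw [hc e he]; omega, fun e he => (hc e he).le, hg, ?_⟩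
    intro v s hs
    rw [Finset.mem_Icc] at hs
    have ha := aa_pos m T hT
    by_cases hsm : s = m
    · subst hsm
      unfold DD
      simp only [pow_zero, Nat.choose_self, Nat.sub_self, Nat.cast_one, mul_one, one_mul]
      refine le_trans ?_ (hd v)
      unfold dg
      norm_cast
      apply Finset.card_le_card
      intro e he
      rw [Finset.mem_filter] at he ⊢
      exact ⟨he.1, he.2.1⟩
    · have h0 : dg E v s = 0 := by
        unfold dg
        rw [Finset.card_eq_zero, Finset.filter_eq_empty_iff]
        rintro e he ⟨_, h3⟩
        have := hc e he
        omega
      rw [h0]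
      unfold DD
      push_cast
      positivity
end

/-- Ajtai–Komlós–Pintz–Spencer–Szemerédi. -/
theorem akpss (m : ℕ) (hm : 1 ≤ m) : ∃ c : ℝ, 0 < c ∧ ∃ d0 : ℝ, 1 ≤ d0 ∧ ∀ d : ℝ, d0 ≤ d →
    ∀ (V : Type) [Fintype V] [DecidableEq V] (U : Finset V) (E : Finset (Finset V)),
      (∀ e ∈ E, e ⊆ U) → (∀ e ∈ E, e.card = m + 1) → Girth5 E →
      (∀ v, ((E.filter (fun e => v ∈ e)).card : ℝ) ≤ d) →
      HasInd E U (c * (Real.log d / d) ^ ((1 : ℝ) / m) * U.card) := by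
  have hm0 : (0 : ℝ) < m := by exact_mod_cast hm
  have hm1 : (1 : ℝ) ≤ m := by exact_mod_cast hm
  refine ⟨1 / 4 * (1 / (6 * 2 ^ m * (4 * m))) ^ ((1 : ℝ) / m), by positivity, ?_⟩
  have hlim : ∀ᶠ d : ℝ in Filter.atTop,
      1000 * m * 2 ^ m * (Real.log d) ^ (m + 2) ≤ d ^ (1 / (2 * (m : ℝ))) := by
    have h1 := isLittleO_log_rpow_rpow_atTop (s := 1 / (2 * (m : ℝ))) ((m : ℝ) + 2) (by positivity)
    have h2 := h1.bound (c := 1 / (1000 * m * 2 ^ m)) (by positivity)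
    filter_upwards [h2, Filter.eventually_ge_atTop (1 : ℝ)] with d hd hd1
    have hl : 0 ≤ Real.log d := Real.log_nonneg hd1
    rw [Real.norm_of_nonneg (by positivity), Real.norm_of_nonneg (by positivity)] at hd
    have e1 : Real.log d ^ ((m : ℝ) + 2) = Real.log d ^ (m + 2) := by
      rw [← Real.rpow_natCast]; push_cast; rfl
    rw [e1, div_mul_eq_mul_div, one_mul, le_div_iff₀ (by positivity)] at hd
    linarith
  have hlog : ∀ᶠ d : ℝ in Filter.atTop, 2 * (m : ℝ) ≤ Real.log d :=
    Real.tendsto_log_atTop.eventually_ge_atTop _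
  obtain ⟨d0, hd0⟩ := Filter.eventually_atTop.mp (hlim.and hlog)
  refine ⟨max d0 1, le_max_right _ _, ?_⟩
  intro d hd V _ _ U E hU hc hg hdeg
  obtain ⟨hd2, hd3⟩ := hd0 d (le_trans (le_max_left _ _) hd)
  have hd1 : 1 ≤ d := le_trans (le_max_right _ _) hd
  have hdpos : 0 < d := by linarith
  set L := Real.log d with hL
  set T : ℕ := ⌊L / (2 * m)⌋₊ with hT
  have hx1 : 1 ≤ L / (2 * m) := by rw [le_div_iff₀ (by positivity)]; linarith
  have hT1 : 1 ≤ T := by rw [hT]; exact Nat.le_floor (by simpa using hx1)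
  have hT1' : (1 : ℝ) ≤ T := by exact_mod_cast hT1
  have hT0 : (0 : ℝ) < T := by linarith
  have hTle : (T : ℝ) ≤ L / (2 * m) := Nat.floor_le (by linarith)
  have hTge : L / (4 * m) ≤ T := by
    have h1 : L / (2 * m) < T + 1 := Nat.lt_floor_add_one _
    have h2 : L / (2 * m) < 2 * T := by linarith
    have e : L / (4 * m) = L / (2 * m) / 2 := by field_simp; norm_num
    rw [e]; linarith
  have hL0 : 0 < L := by linarith
  have ha := aa_pos m T hT1
  have ha1 : aa m T ≤ 1 := by
    unfold aa
    rw [div_le_one (by positivity)]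
    have h1 : (1 : ℝ) ≤ 2 ^ m := one_le_pow₀ (by norm_num)
    have h2 : (1 : ℝ) ≤ (T : ℝ) ^ (m - 1) := one_le_pow₀ hT1'
    nlinarith
  set q0 : ℝ := (aa m T / d) ^ ((1 : ℝ) / m) with hq0
  have hq0pos : 0 < q0 := by positivity
  have hq0m : q0 ^ m = aa m T / d := by
    rw [hq0, ← Real.rpow_natCast, ← Real.rpow_mul (by positivity)]
    rw [one_div_mul_cancel hm0.ne', Real.rpow_one]
  have hq0le : q0 ≤ d ^ (-(1 / (m : ℝ))) := by
    rw [Real.rpow_neg hdpos.le, ← Real.inv_rpow hdpos.le, hq0]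
    apply Real.rpow_le_rpow (by positivity) _ (by positivity)
    rw [inv_eq_one_div]
    gcongr
  have h2T : (2 : ℝ) ^ T ≤ d ^ (1 / (2 * (m : ℝ))) := by
    calc (2 : ℝ) ^ T ≤ (Real.exp 1) ^ T := by
          apply pow_le_pow_left₀ (by norm_num)
          have := Real.exp_one_gt_d9; linarith
      _ = Real.exp T := by rw [← Real.exp_nat_mul, mul_one]
      _ ≤ Real.exp (L * (1 / (2 * m))) := by
          apply Real.exp_le_exp.mpr; rw [mul_one_div]; exact hTle
      _ = _ := by rw [Real.rpow_def_of_pos hdpos]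
  have hbig : 1000 * m * 2 ^ m * (T : ℝ) ^ (m + 2) * (2 ^ T * q0) ≤ 1 := by
    have hTL : (T : ℝ) ≤ L := by
      refine hTle.trans ?_
      apply div_le_self hL0.le; linarith
    calc 1000 * m * 2 ^ m * (T : ℝ) ^ (m + 2) * (2 ^ T * q0)
        ≤ 1000 * m * 2 ^ m * L ^ (m + 2) * (d ^ (1 / (2 * (m : ℝ))) * d ^ (-(1 / (m : ℝ)))) := by
          gcongr
      _ ≤ d ^ (1 / (2 * (m : ℝ))) * (d ^ (1 / (2 * (m : ℝ))) * d ^ (-(1 / (m : ℝ)))) := by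
          gcongr
      _ = 1 := by
          rw [← Real.rpow_add hdpos, ← Real.rpow_add hdpos]
          rw [show 1 / (2 * (m : ℝ)) + (1 / (2 * (m : ℝ)) + -(1 / (m : ℝ))) = 0 by
            field_simp; norm_num]
          exact Real.rpow_zero d
  obtain ⟨I, hI1, hI2, hI3⟩ := iter0 hm hT1 hq0pos hbig U E hU hc hg (by
    intro v
    rw [hq0m]
    refine (hdeg v).trans (le_of_eq ?_)
    field_simp)
  refine ⟨I, hI1, hI2, le_trans ?_ hI3⟩
  apply mul_le_mul_of_nonneg_right _ (Nat.cast_nonneg _)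
  have e1 : (T : ℝ) = ((T : ℝ) ^ m) ^ ((1 : ℝ) / m) := by
    rw [← Real.rpow_natCast, ← Real.rpow_mul hT0.le, mul_one_div_cancel hm0.ne', Real.rpow_one]
  have e2 : q0 * T = (T / (6 * 2 ^ m * d)) ^ ((1 : ℝ) / m) := by
    have e5 : q0 * T = q0 * ((T : ℝ) ^ m) ^ ((1 : ℝ) / m) := congrArg (q0 * ·) e1
    rw [e5, hq0, ← Real.mul_rpow (by positivity) (by positivity)]
    congr 1
    unfold aa
    have e3 : (T : ℝ) ^ m = T ^ (m - 1) * T := by rw [← pow_succ]; congr 1; omega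
    rw [e3]
    field_simp
  have e4 : (1 / (6 * 2 ^ m * (4 * (m : ℝ)))) ^ ((1 : ℝ) / m) * (L / d) ^ ((1 : ℝ) / m) ≤ q0 * T := by
    rw [e2, ← Real.mul_rpow (by positivity) (by positivity)]
    apply Real.rpow_le_rpow (by positivity) _ (by positivity)
    calc 1 / (6 * 2 ^ m * (4 * (m : ℝ))) * (L / d) = (L / (4 * m)) / (6 * 2 ^ m * d) := by
          field_simp
      _ ≤ _ := by gcongr
  linarith

end BES

set_option linter.unusedSectionVars false

namespace BES

section
variable {α : Type*} [DecidableEq α]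

/-- the potential of a family of sets -/
def phi (m b r : ℕ) (T : Finset (Finset α)) : ℤ :=
  (m : ℤ) * (((T.sup id).card : ℤ) - r) - ((T.card : ℤ) - 1) * (m * b + 1)

lemma phi_union (m b r : ℕ) (A B : Finset (Finset α)) :
    phi m b r (A ∪ B) + phi m b r (A ∩ B) ≤ phi m b r A + phi m b r B := by
  unfold phi
  have h1 : ((A ∪ B).card : ℤ) + (A ∩ B).card = A.card + B.card := by
    exact_mod_cast Finset.card_union_add_card_inter A B
  have h2 : (((A ∪ B).sup id).card : ℤ) + ((A ∩ B).sup id).card ≤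
      (A.sup id).card + (B.sup id).card := by
    have e1 : (A ∪ B).sup id = A.sup id ∪ B.sup id := Finset.sup_union
    have e2 : (A ∩ B).sup id ⊆ A.sup id ∩ B.sup id := by
      apply Finset.subset_inter
      · exact Finset.sup_mono Finset.inter_subset_left
      · exact Finset.sup_mono Finset.inter_subset_right
    have e3 := Finset.card_le_card e2
    have e4 := Finset.card_union_add_card_inter (A.sup id) (B.sup id)
    rw [e1]
    norm_cast
    omega
  have h3 : (m : ℤ) * ((((A ∪ B).sup id).card : ℤ) + ((A ∩ B).sup id).card) ≤
      m * ((A.sup id).card + (B.sup id).card) := mul_le_mul_of_nonneg_left h2 (by positivity)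
  have h4 : (((A ∪ B).card : ℤ) + (A ∩ B).card) * (m * b + 1) =
    (A.card + B.card) * (m * b + 1) := by rw [h1]
  nlinarith

/-- a family without bad configurations -/
structure Good (m b r : ℕ) (R : Finset (Finset α)) : Prop where
  card : ∀ A ∈ R, A.card = r
  nonneg : ∀ T ⊆ R, 2 ≤ T.card → T.card ≤ 4 * (m + 1) → 0 ≤ phi m b r T

lemma Good.nonneg' {m b r : ℕ} {R : Finset (Finset α)} (h : Good m b r R) {T : Finset (Finset α)}
    (hT : T ⊆ R) (h1 : 1 ≤ T.card) (h2 : T.card ≤ 4 * (m + 1)) : 0 ≤ phi m b r T := by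
  by_cases h3 : T.card = 1
  · obtain ⟨A, rfl⟩ := Finset.card_eq_one.mp h3
    unfold phi
    simp [h.card A (hT (by simp))]
  · exact h.nonneg T hT (by omega) h2

lemma Good.pos {m b r : ℕ} {R : Finset (Finset α)} (h : Good m b r R) {T : Finset (Finset α)}
    (hT : T ⊆ R) (h1 : 2 ≤ T.card) (h2 : T.card ≤ m) : 0 < phi m b r T := by
  have h3 := h.nonneg T hT h1 (by omega)
  rcases h3.lt_or_eq with h4 | h4
  · exact h4
  · exfalso
    unfold phi at h4
    have h5 : (m : ℤ) ∣ (T.card : ℤ) - 1 :=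
      ⟨((T.sup id).card : ℤ) - r - ((T.card : ℤ) - 1) * b, by linarith⟩
    have h6 := Int.le_of_dvd (by omega) h5
    omega

lemma Good.contra {m b r : ℕ} {R : Finset (Finset α)} (h : Good m b r R)
    {A S : Finset (Finset α)} (hA : A ⊆ R) (hS : S ⊆ R) (h1 : phi m b r A ≤ 0)
    (h2 : phi m b r S ≤ 0) (h3 : A.card + S.card ≤ 4 * (m + 1))
    (h4 : 2 ≤ (A ∩ S).card) (h5 : (A ∩ S).card ≤ m) : False := by
  have e1 := phi_union m b r A S
  have e2 := h.pos (Finset.inter_subset_left.trans hA) h4 h5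
  have e3 := h.nonneg' (Finset.union_subset hA hS)
    (le_trans (by omega) (Finset.card_le_card
      (Finset.inter_subset_left.trans Finset.subset_union_left : A ∩ S ⊆ A ∪ S)))
    ((Finset.card_union_le A S).trans h3)
  omega

lemma Good.union {m b r : ℕ} {R : Finset (Finset α)} (h : Good m b r R)
    {A S : Finset (Finset α)} (hA : A ⊆ R) (h1 : phi m b r A ≤ 0)
    (h2 : phi m b r S ≤ 0) (h3 : A.card ≤ 4 * (m + 1))
    (h4 : (A ∩ S).Nonempty) : phi m b r (A ∪ S) ≤ 0 := by
  have e1 := phi_union m b r A S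
  have e2 := h.nonneg' (Finset.inter_subset_left.trans hA : A ∩ S ⊆ R) (Finset.card_pos.mpr h4)
    ((Finset.card_le_card Finset.inter_subset_left).trans h3)
  omega

lemma girth {m b r : ℕ} (hm : 2 ≤ m) {R : Finset (Finset α)} (h : Good m b r R)
    (E : Finset (Finset (Finset α))) (hE : ∀ S ∈ E, S ⊆ R ∧ S.card = m + 1 ∧
      (S.sup id).card ≤ r + (m * b + 1)) : Girth5 E := by
  have hphi : ∀ S ∈ E, phi m b r S ≤ 0 := by
    intro S hS
    obtain ⟨_, h1, h2⟩ := hE S hS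
    unfold phi
    rw [h1]
    push_cast
    have : ((S.sup id).card : ℤ) - r ≤ m * b + 1 := by
      have : ((S.sup id).card : ℤ) ≤ r + (m * b + 1) := by exact_mod_cast h2
      linarith
    have := mul_le_mul_of_nonneg_left this (Nat.cast_nonneg (α := ℤ) m)
    linarith
  have hlin : ∀ e ∈ E, ∀ f ∈ E, e ≠ f → ∀ x y, x ∈ e → x ∈ f → y ∈ e → y ∈ f → x = y := by
    intro e he f hf hef x y hxe hxf hye hyf
    by_contra hxy
    obtain ⟨e1, e2, _⟩ := hE e he
    obtain ⟨f1, f2, _⟩ := hE f hf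
    apply h.contra e1 f1 (hphi e he) (hphi f hf) (by omega)
    · exact Finset.one_lt_card.mpr ⟨x, by simp [hxe, hxf], y, by simp [hye, hyf], hxy⟩
    · by_contra hc
      have h3 : e ∩ f = e := Finset.eq_of_subset_of_card_le Finset.inter_subset_left (by omega)
      have h4 : e ∩ f = f := Finset.eq_of_subset_of_card_le Finset.inter_subset_right (by omega)
      exact hef (h3.symm.trans h4)
  have hcap : ∀ e ∈ E, ∀ f ∈ E, e ≠ f → (e ∩ f).card ≤ 1 := by
    intro e he f hf hef
    rw [Finset.card_le_one]
    intro x hx y hy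
    rw [Finset.mem_inter] at hx hy
    exact hlin e he f hf hef x y hx.1 hx.2 hy.1 hy.2
  have htri : ∀ e ∈ E, ∀ f ∈ E, ∀ g ∈ E, e ≠ f → f ≠ g → e ≠ g → ∀ x y z, x ∈ e → x ∈ f →
      y ∈ f → y ∈ g → z ∈ g → z ∈ e → x ≠ y → y ≠ z → x ≠ z → False := by
    intro e he f hf g hg hef hfg heg x y z hxe hxf hyf hyg hzg hze hxy hyz hxz
    obtain ⟨e1, e2, _⟩ := hE e he
    obtain ⟨f1, f2, _⟩ := hE f hf
    obtain ⟨g1, g2, _⟩ := hE g hg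
    have hu := h.union e1 (hphi e he) (hphi f hf) (by omega) ⟨x, by simp [hxe, hxf]⟩
    have hcu := Finset.card_union_le e f
    apply h.contra (Finset.union_subset e1 f1) g1 hu (hphi g hg) (by omega)
    · exact Finset.one_lt_card.mpr ⟨y, by simp [hyf, hyg], z, by simp [hze, hzg], hyz⟩
    · rw [Finset.union_inter_distrib_right]
      have := Finset.card_union_le (e ∩ g) (f ∩ g)
      have := hcap e he g hg heg
      have := hcap f hf g hg hfg
      omega
  refine ⟨hlin, htri, ?_⟩
  intro e he f hf g hg k hk hef heg hek hfg hfk hgk x y z w hxe hxf hyf hyg hzg hzk hwk hwe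
    hxy hxz hxw hyz hyw hzw
  obtain ⟨e1, e2, _⟩ := hE e he
  obtain ⟨f1, f2, _⟩ := hE f hf
  obtain ⟨g1, g2, _⟩ := hE g hg
  obtain ⟨k1, k2, _⟩ := hE k hk
  have hcu := Finset.card_union_le e f
  have hu := h.union e1 (hphi e he) (hphi f hf) (by omega) ⟨x, by simp [hxe, hxf]⟩
  have hu2 := h.union (Finset.union_subset e1 f1) hu (hphi g hg) (by omega)
    ⟨y, by simp [hyf, hyg]⟩
  have hcu2 := Finset.card_union_le (e ∪ f) g
  have hempty : f ∩ k = ∅ := by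
    rw [Finset.eq_empty_iff_forall_notMem]
    intro B hB
    rw [Finset.mem_inter] at hB
    refine htri e he f hf k hk hef hfk hek x B w hxe hxf hB.1 hB.2 hwk hwe ?_ ?_ hxw
    · rintro rfl
      exact hxw (hlin e he k hk hek x w hxe hB.2 hwe hwk)
    · rintro rfl
      exact hxw (hlin e he f hf hef x B hxe hxf hwe hB.1)
  apply h.contra (Finset.union_subset (Finset.union_subset e1 f1) g1) k1 hu2 (hphi k hk) (by omega)
  · exact Finset.one_lt_card.mpr ⟨z, by simp [hzg, hzk], w, by simp [hwe, hwk], hzw⟩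
  · rw [Finset.union_inter_distrib_right, Finset.union_inter_distrib_right, hempty,
      Finset.union_empty]
    have := Finset.card_union_le (e ∩ k) (g ∩ k)
    have := hcap e he k hk hek
    have := hcap g hg k hk hgk
    omega

end

section
variable {V : Type*} [Fintype V] [DecidableEq V]

/-- the deletion method -/
lemma deletion (base : Finset V) (Conf Bad : Finset (Finset V)) (m : ℕ) (Λ π : ℝ)
    (hΛ : 0 < Λ) (h0 : 0 ≤ π) (h1 : π ≤ 1)
    (hC : ∀ S ∈ Conf, S.card = m + 1) (hB : ∀ T ∈ Bad, T.Nonempty) :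
    ∃ R ⊆ base, (∀ T ∈ Bad, ¬ T ⊆ R) ∧
      (∀ v, ((((Conf.filter (fun S => S ⊆ R)).filter (fun S => v ∈ S)).card : ℕ) : ℝ)
        ≤ (m + 1) * Λ) ∧
      π * base.card - Conf.card * π ^ (m + 1) / Λ - ∑ T ∈ Bad, π ^ T.card ≤ R.card := by
  classical
  have hEs : ∀ T : Finset V, EE (fun _ : V => π) (fun X => ind (∀ i ∈ T, i ∈ X)) = π ^ T.card := by
    intro T; rw [EE_subset]; simp
  have hEE : EE (fun _ : V => π) (fun X => (∑ v ∈ base, ind (v ∈ X)) -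
      Λ⁻¹ * (∑ S ∈ Conf, ind (∀ i ∈ S, i ∈ X)) - ∑ T ∈ Bad, ind (∀ i ∈ T, i ∈ X)) =
      π * base.card - Conf.card * π ^ (m + 1) / Λ - ∑ T ∈ Bad, π ^ T.card := by
    rw [EE_sub, EE_sub, EE_mul_left, EE_sum, EE_sum, EE_sum]
    congr 1
    · congr 1
      · rw [Finset.sum_congr rfl (fun v _ => EE_mem _ v)]
        simp [mul_comm]
      · rw [Finset.sum_congr rfl (fun S hS => (hEs S).trans (by rw [hC S hS]))]
        rw [Finset.sum_const, nsmul_eq_mul]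
        field_simp
    · exact Finset.sum_congr rfl (fun T _ => hEs T)
  obtain ⟨X, hX⟩ := exists_ge_EE (p := fun _ : V => π) (fun _ => h0) (fun _ => h1)
    (fun X => (∑ v ∈ base, ind (v ∈ X)) -
      Λ⁻¹ * (∑ S ∈ Conf, ind (∀ i ∈ S, i ∈ X)) - ∑ T ∈ Bad, ind (∀ i ∈ T, i ∈ X))
  rw [hEE] at hX
  have hc1 : ∑ v ∈ base, ind (v ∈ X) = ((base.filter (fun v => v ∈ X)).card : ℝ) :=
    (card_filter_ind base _).symm
  have hc2 : ∑ S ∈ Conf, ind (∀ i ∈ S, i ∈ X) = ((Conf.filter (fun S => S ⊆ X)).card : ℝ) :=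
    (card_filter_ind Conf (fun S => S ⊆ X)).symm
  have hc3 : ∑ T ∈ Bad, ind (∀ i ∈ T, i ∈ X) = ((Bad.filter (fun T => T ⊆ X)).card : ℝ) :=
    (card_filter_ind Bad (fun S => S ⊆ X)).symm
  simp only [hc1, hc2, hc3] at hX
  set CX := Conf.filter (fun S => S ⊆ X) with hCX
  set BX := Bad.filter (fun T => T ⊆ X) with hBX
  set heavy : Finset V := Finset.univ.filter
    (fun v => (m + 1) * Λ < ((CX.filter (fun S => v ∈ S)).card : ℝ)) with hheavy
  choose g hg using hB
  set rem : Finset V := BX.attach.image (fun T => g T.1 (Finset.mem_filter.mp T.2).1) with hrem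
  have hremc : (rem.card : ℝ) ≤ BX.card := by
    have := Finset.card_image_le (s := BX.attach)
      (f := fun T => g T.1 (Finset.mem_filter.mp T.2).1)
    rw [Finset.card_attach] at this
    exact_mod_cast this
  have hheavyc : (heavy.card : ℝ) ≤ Λ⁻¹ * CX.card := by
    have e1 : ∑ v : V, ((CX.filter (fun S => v ∈ S)).card : ℝ) = (m + 1) * CX.card := by
      have e2 : ∑ v : V, (CX.filter (fun S => v ∈ S)).card = ∑ S ∈ CX, S.card := by
        simp only [Finset.card_filter]
        rw [Finset.sum_comm]
        apply Finset.sum_congr rfl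
        intro S _
        rw [← Finset.card_filter]
        simp
      have e3 : ∑ S ∈ CX, S.card = CX.card * (m + 1) := by
        rw [Finset.sum_congr rfl (fun S hS => hC S (Finset.mem_filter.mp hS).1)]
        rw [Finset.sum_const, smul_eq_mul]
      rw [e3] at e2
      have e4 : ((∑ v : V, (CX.filter (fun S => v ∈ S)).card : ℕ) : ℝ)
        = ((CX.card * (m + 1) : ℕ) : ℝ) := congrArg _ e2
      push_cast at e4
      linarith
    have e5 : ∑ v ∈ heavy, ((m + 1) * Λ : ℝ) ≤ ∑ v : V, ((CX.filter (fun S => v ∈ S)).card : ℝ) := by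
      calc ∑ v ∈ heavy, ((m + 1) * Λ : ℝ) ≤ ∑ v ∈ heavy, ((CX.filter (fun S => v ∈ S)).card : ℝ) :=
            Finset.sum_le_sum (fun v hv => (Finset.mem_filter.mp hv).2.le)
        _ ≤ _ := Finset.sum_le_univ_sum_of_nonneg (fun v => Nat.cast_nonneg _)
    rw [e1, Finset.sum_const, nsmul_eq_mul] at e5
    have e6 : (heavy.card : ℝ) * Λ ≤ CX.card := by
      have : (0 : ℝ) < m + 1 := by positivity
      nlinarith
    rw [inv_mul_eq_div, le_div_iff₀ hΛ]
    exact e6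
  refine ⟨((base.filter (fun v => v ∈ X)) \ heavy) \ rem, ?_, ?_, ?_, ?_⟩
  · exact Finset.sdiff_subset.trans (Finset.sdiff_subset.trans (Finset.filter_subset _ _))
  · intro T hT hTR
    have hTX : T ∈ BX := by
      rw [hBX, Finset.mem_filter]
      refine ⟨hT, fun x hx => ?_⟩
      have := hTR hx
      simp only [Finset.mem_sdiff, Finset.mem_filter] at this
      exact this.1.1.2
    have h2 := hTR (hg T hT)
    rw [Finset.mem_sdiff] at h2
    apply h2.2
    rw [hrem, Finset.mem_image]
    exact ⟨⟨T, hTX⟩, Finset.mem_attach _ _, rfl⟩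
  · intro v
    by_cases hv : v ∈ ((base.filter (fun v => v ∈ X)) \ heavy) \ rem
    · have h2 : v ∉ heavy := by
        simp only [Finset.mem_sdiff] at hv; exact hv.1.2
      rw [hheavy, Finset.mem_filter] at h2
      push Not at h2
      refine le_trans ?_ (h2 (Finset.mem_univ v))
      norm_cast
      apply Finset.card_le_card
      intro S hS
      rw [Finset.mem_filter, Finset.mem_filter] at hS
      rw [Finset.mem_filter, hCX, Finset.mem_filter]
      refine ⟨⟨hS.1.1, fun x hx => ?_⟩, hS.2⟩
      have := hS.1.2 hx
      simp only [Finset.mem_sdiff, Finset.mem_filter] at this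
      exact this.1.1.2
    · rw [Finset.filter_eq_empty_iff.mpr]
      · simp; positivity
      · intro S hS hvS
        exact hv ((Finset.mem_filter.mp hS).2 hvS)
  · have e1 := Finset.le_card_sdiff rem ((base.filter (fun v => v ∈ X)) \ heavy)
    have e2 := Finset.le_card_sdiff heavy (base.filter (fun v => v ∈ X))
    have e3 : ((base.filter (fun v => v ∈ X)).card : ℝ) ≤
        (((base.filter (fun v => v ∈ X)) \ heavy) \ rem).card + heavy.card + rem.card := by
      norm_cast
      omega
    linarith

end

lemma count_union (n w : ℕ) (hw : w ≤ n) :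
    ((Finset.univ : Finset (Finset (Finset (Fin n)))).filter
      (fun T => (T.sup id).card ≤ w)).card ≤ n ^ w * 2 ^ (2 ^ w) := by
  have h1 : (Finset.univ : Finset (Finset (Finset (Fin n)))).filter (fun T => (T.sup id).card ≤ w)
      ⊆ (Finset.powersetCard w (Finset.univ : Finset (Fin n))).biUnion
        (fun W => W.powerset.powerset) := by
    intro T hT
    rw [Finset.mem_filter] at hT
    obtain ⟨W, hW1, hW2⟩ := Finset.exists_superset_card_eq hT.2 (by simpa using hw)
    rw [Finset.mem_biUnion]
    refine ⟨W, by simp [Finset.mem_powersetCard, hW2], ?_⟩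
    rw [Finset.mem_powerset]
    intro A hA
    rw [Finset.mem_powerset]
    exact (Finset.le_sup (f := id) hA).trans hW1
  refine (Finset.card_le_card h1).trans ?_
  refine (Finset.card_biUnion_le_card_mul _ _ (2 ^ (2 ^ w)) ?_).trans ?_
  · intro W hW
    rw [Finset.mem_powersetCard] at hW
    rw [Finset.card_powerset, Finset.card_powerset, hW.2]
  · rw [Finset.card_powersetCard, Finset.card_univ, Fintype.card_fin]
    exact Nat.mul_le_mul_right _ (Nat.choose_le_pow n w)

end BES

set_option linter.unusedSectionVars false

namespace BES

/-- exponent of the sampling probability -/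
noncomputable def gam (m : ℕ) : ℝ := 1 / (8 * m * (m + 1))
/-- exponent -/
noncomputable def ex (m b : ℕ) : ℝ := -((b : ℝ) + 1 / m) + gam m

lemma gam_pos {m : ℕ} (hm : 2 ≤ m) : 0 < gam m := by
  have : (0 : ℝ) < m := by exact_mod_cast (by omega : 0 < m)
  unfold gam; positivity

lemma bad_pointwise {α : Type*} [DecidableEq α] {m b r : ℕ} (hm : 2 ≤ m) (x : ℝ) (hx : 1 ≤ x)
    (T : Finset (Finset α)) (h1 : 1 ≤ T.card) (h2 : T.card ≤ 4 * (m + 1))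
    (h3 : phi m b r T < 0) :
    (x ^ ex m b) ^ T.card ≤
      x ^ ((r : ℝ) + ex m b - 1 / (2 * m)) * (x ^ ((T.sup id).card))⁻¹ := by
  have hx0 : 0 < x := by linarith
  have hm0 : (0 : ℝ) < m := by exact_mod_cast (by omega : 0 < m)
  rw [← Real.rpow_natCast, ← Real.rpow_natCast, ← Real.rpow_mul hx0.le, ← Real.rpow_neg hx0.le,
    ← Real.rpow_add hx0]
  apply Real.rpow_le_rpow_of_exponent_le hx
  unfold phi at h3
  set w := (T.sup id).card
  set j := T.card
  have h4 : (m : ℝ) * ((w : ℝ) - r) - ((j : ℝ) - 1) * (m * b + 1) ≤ -1 := by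
    have : (m : ℤ) * ((w : ℤ) - r) - ((j : ℤ) - 1) * (m * b + 1) ≤ -1 := by omega
    exact_mod_cast this
  have h5 : ((w : ℝ) - r) - ((j : ℝ) - 1) * (b + 1 / m) ≤ - (1 / m) := by
    have e : ((w : ℝ) - r) - ((j : ℝ) - 1) * (b + 1 / m) =
      (m * ((w : ℝ) - r) - ((j : ℝ) - 1) * (m * b + 1)) / m := by field_simp
    rw [e, ← neg_div]
    gcongr
  have h6 : ((j : ℝ) - 1) * gam m ≤ 1 / (2 * m) := by
    have hj : (j : ℝ) - 1 ≤ 4 * (m + 1) := by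
      have : (j : ℝ) ≤ 4 * (m + 1) := by exact_mod_cast h2
      linarith
    calc ((j : ℝ) - 1) * gam m ≤ 4 * (m + 1) * gam m :=
          mul_le_mul_of_nonneg_right hj (gam_pos hm).le
      _ = 1 / (2 * m) := by unfold gam; field_simp; norm_num
  have h7 : 1 / (m : ℝ) = 1 / (2 * m) + 1 / (2 * m) := by field_simp; norm_num
  have e : ex m b = -((b : ℝ) + 1 / m) + gam m := rfl
  rw [e]
  linarith

lemma bad_sum {n m b r : ℕ} (hm : 2 ≤ m) (hn : 4 * (m + 1) * r + 1 ≤ n)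
    (Bad : Finset (Finset (Finset (Fin n))))
    (hB : ∀ T ∈ Bad, (∀ A ∈ T, A.card = r) ∧ 2 ≤ T.card ∧ T.card ≤ 4 * (m + 1) ∧ phi m b r T < 0) :
    ∑ T ∈ Bad, ((n : ℝ) ^ ex m b) ^ T.card ≤
      ((4 * (m + 1) * r + 1 : ℕ) : ℝ) * 2 ^ (2 ^ (4 * (m + 1) * r)) *
        (n : ℝ) ^ ((r : ℝ) + ex m b - 1 / (2 * m)) := by
  have hn1 : (1 : ℝ) ≤ n := by exact_mod_cast (by omega : 1 ≤ n)
  have hn0 : (0 : ℝ) < n := by linarith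
  have hmaps : ∀ T ∈ Bad, (T.sup id).card ∈ Finset.range (4 * (m + 1) * r + 1) := by
    intro T hT
    obtain ⟨h1, h2, h3, h4⟩ := hB T hT
    rw [Finset.mem_range]
    have e1 : (T.sup id).card ≤ ∑ A ∈ T, A.card := by
      rw [Finset.sup_eq_biUnion]; exact Finset.card_biUnion_le
    rw [Finset.sum_congr rfl h1, Finset.sum_const, smul_eq_mul] at e1
    have := Nat.mul_le_mul_right r h3
    omega
  rw [← Finset.sum_fiberwise_of_maps_to hmaps]
  have key : ∀ w ∈ Finset.range (4 * (m + 1) * r + 1),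
      ∑ T ∈ Bad with (T.sup id).card = w, ((n : ℝ) ^ ex m b) ^ T.card ≤
      2 ^ (2 ^ (4 * (m + 1) * r)) * (n : ℝ) ^ ((r : ℝ) + ex m b - 1 / (2 * m)) := by
    intro w hw
    rw [Finset.mem_range] at hw
    have h1 : ∀ T ∈ Bad.filter (fun T => (T.sup id).card = w), ((n : ℝ) ^ ex m b) ^ T.card ≤
        (n : ℝ) ^ ((r : ℝ) + ex m b - 1 / (2 * m)) * ((n : ℝ) ^ w)⁻¹ := by
      intro T hT
      rw [Finset.mem_filter] at hT
      obtain ⟨_, h2, h3, h4⟩ := hB T hT.1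
      have := bad_pointwise hm (n : ℝ) hn1 T (by omega) h3 h4
      rw [hT.2] at this
      exact this
    refine (Finset.sum_le_sum h1).trans ?_
    rw [Finset.sum_const, nsmul_eq_mul]
    have h2 : ((Bad.filter (fun T => (T.sup id).card = w)).card : ℝ) ≤
        (n : ℝ) ^ w * 2 ^ (2 ^ (4 * (m + 1) * r)) := by
      have e1 : (Bad.filter (fun T => (T.sup id).card = w)).card ≤ n ^ w * 2 ^ (2 ^ w) := by
        refine le_trans (Finset.card_le_card ?_) (count_union n w (by omega))
        intro T hT
        rw [Finset.mem_filter] at hT ⊢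
        exact ⟨Finset.mem_univ _, hT.2.le⟩
      have e2 : n ^ w * 2 ^ (2 ^ w) ≤ n ^ w * 2 ^ (2 ^ (4 * (m + 1) * r)) := by
        apply Nat.mul_le_mul_left
        apply Nat.pow_le_pow_right (by norm_num)
        exact Nat.pow_le_pow_right (by norm_num) (by omega)
      exact_mod_cast e1.trans e2
    calc ((Bad.filter (fun T => (T.sup id).card = w)).card : ℝ) *
          ((n : ℝ) ^ ((r : ℝ) + ex m b - 1 / (2 * m)) * ((n : ℝ) ^ w)⁻¹)
        ≤ ((n : ℝ) ^ w * 2 ^ (2 ^ (4 * (m + 1) * r))) *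
          ((n : ℝ) ^ ((r : ℝ) + ex m b - 1 / (2 * m)) * ((n : ℝ) ^ w)⁻¹) := by
          gcongr
      _ = _ := by
          have : (n : ℝ) ^ w ≠ 0 := by positivity
          generalize (2 : ℝ) ^ (2 ^ (4 * (m + 1) * r)) = C
          field_simp
  refine (Finset.sum_le_sum key).trans ?_
  rw [Finset.sum_const, nsmul_eq_mul, Finset.card_range, ← mul_assoc]

lemma conf_sum {n m b r : ℕ} (hm : 2 ≤ m) (hn : r + (m * b + 1) ≤ n)
    (Conf : Finset (Finset (Finset (Fin n))))
    (hC : ∀ S ∈ Conf, (S.sup id).card ≤ r + (m * b + 1)) :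
    (Conf.card : ℝ) * ((n : ℝ) ^ ex m b) ^ (m + 1) ≤
      2 ^ (2 ^ (r + (m * b + 1))) * ((n : ℝ) ^ ((r : ℝ) + ex m b) * (n : ℝ) ^ (m * gam m)) := by
  have hn0 : (0 : ℝ) < n := by exact_mod_cast (by omega : 0 < n)
  have hm0 : (0 : ℝ) < m := by exact_mod_cast (by omega : 0 < m)
  have h1 : (Conf.card : ℝ) ≤ (n : ℝ) ^ (r + (m * b + 1)) * 2 ^ (2 ^ (r + (m * b + 1))) := by
    have : Conf.card ≤ n ^ (r + (m * b + 1)) * 2 ^ (2 ^ (r + (m * b + 1))) := by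
      refine le_trans (Finset.card_le_card ?_) (count_union n _ hn)
      intro S hS
      rw [Finset.mem_filter]
      exact ⟨Finset.mem_univ _, hC S hS⟩
    exact_mod_cast this
  have h2 : (n : ℝ) ^ (r + (m * b + 1)) * ((n : ℝ) ^ ex m b) ^ (m + 1) =
      (n : ℝ) ^ ((r : ℝ) + ex m b) * (n : ℝ) ^ (m * gam m) := by
    rw [← Real.rpow_natCast, ← Real.rpow_natCast, ← Real.rpow_mul hn0.le, ← Real.rpow_add hn0,
      ← Real.rpow_add hn0]
    congr 1
    unfold ex
    push_cast
    field_simp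
    ring
  calc (Conf.card : ℝ) * ((n : ℝ) ^ ex m b) ^ (m + 1)
      ≤ ((n : ℝ) ^ (r + (m * b + 1)) * 2 ^ (2 ^ (r + (m * b + 1)))) *
        ((n : ℝ) ^ ex m b) ^ (m + 1) := by gcongr
    _ = 2 ^ (2 ^ (r + (m * b + 1))) *
        ((n : ℝ) ^ (r + (m * b + 1)) * ((n : ℝ) ^ ex m b) ^ (m + 1)) := by ring
    _ = _ := by rw [h2]

lemma choose_lb {n r : ℕ} (hn : 2 * r ≤ n) :
    1 / (2 ^ r * (r.factorial : ℝ)) * (n : ℝ) ^ r ≤ (n.choose r : ℝ) := by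
  have h1 := Nat.pow_le_choose (α := ℝ) r n
  have h2 : ((n : ℝ) / 2) ^ r ≤ ((n + 1 - r : ℕ) : ℝ) ^ r := by
    apply pow_le_pow_left₀ (by positivity)
    rw [div_le_iff₀ (by norm_num)]
    norm_cast
    omega
  have hf : (0 : ℝ) < r.factorial := by exact_mod_cast Nat.factorial_pos r
  calc 1 / (2 ^ r * (r.factorial : ℝ)) * (n : ℝ) ^ r = ((n : ℝ) / 2) ^ r / r.factorial := by
        rw [div_pow]; field_simp
    _ ≤ ((n + 1 - r : ℕ) : ℝ) ^ r / r.factorial := by gcongr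
    _ ≤ _ := by exact_mod_cast h1

/-- sampling and deletion -/
theorem sample (m b r : ℕ) (hm : 2 ≤ m) (hb : 1 ≤ b) :
    ∃ κ : ℝ, 0 < κ ∧ ∃ K : ℝ, 1 ≤ K ∧ ∃ N : ℕ, ∀ n : ℕ, N ≤ n →
      ∃ R : Finset (Finset (Fin n)), Good m b r R ∧
        (∀ v, ((((Finset.univ.filter (fun S : Finset (Finset (Fin n)) => S ⊆ R ∧ S.card = m + 1 ∧
          (S.sup id).card ≤ r + (m * b + 1))).filter (fun S => v ∈ S)).card : ℕ) : ℝ) ≤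
            K * (n : ℝ) ^ (m * gam m)) ∧
        κ * (n : ℝ) ^ ((r : ℝ) + ex m b) ≤ R.card := by
  have hm0 : (0 : ℝ) < m := by exact_mod_cast (by omega : 0 < m)
  have hm1 : (1 : ℝ) ≤ m := by exact_mod_cast (by omega : 1 ≤ m)
  have hb1 : (1 : ℝ) ≤ b := by exact_mod_cast hb
  obtain ⟨κ, hκ⟩ : ∃ κ : ℝ, κ = 1 / (2 ^ r * (r.factorial : ℝ)) := ⟨_, rfl⟩
  have hf : (1 : ℝ) ≤ r.factorial := by exact_mod_cast Nat.factorial_pos r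
  have h2r : (1 : ℝ) ≤ 2 ^ r := one_le_pow₀ (by norm_num)
  have hκ0 : 0 < κ := by rw [hκ]; positivity
  have hκ1 : κ ≤ 1 := by
    rw [hκ, div_le_one (by positivity)]; nlinarith
  obtain ⟨C1, hC1⟩ : ∃ C1 : ℝ, C1 = 2 ^ (2 ^ (r + (m * b + 1))) := ⟨_, rfl⟩
  have hC11 : 1 ≤ C1 := by rw [hC1]; exact one_le_pow₀ (by norm_num)
  obtain ⟨C2, hC2⟩ : ∃ C2 : ℝ,
      C2 = ((4 * (m + 1) * r + 1 : ℕ) : ℝ) * 2 ^ (2 ^ (4 * (m + 1) * r)) := ⟨_, rfl⟩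
  have hC20 : 0 < C2 := by rw [hC2]; positivity
  have hK1 : 1 ≤ C1 * (4 / κ) := by
    have : 1 ≤ 4 / κ := by rw [le_div_iff₀ hκ0]; linarith
    nlinarith
  have hγ := gam_pos hm
  have hγ1 : gam m ≤ 1 := by
    unfold gam; rw [div_le_one (by positivity)]; nlinarith
  have hlim : ∀ᶠ n : ℕ in Filter.atTop, C2 * (n : ℝ) ^ (-(1 / (2 * (m : ℝ)))) ≤ κ / 4 := by
    have h1 : Filter.Tendsto (fun n : ℕ => C2 * (n : ℝ) ^ (-(1 / (2 * (m : ℝ))))) Filter.atTop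
        (nhds (C2 * 0)) :=
      ((tendsto_rpow_neg_atTop (by positivity)).comp tendsto_natCast_atTop_atTop).const_mul _
    rw [mul_zero] at h1
    exact (h1.eventually (gt_mem_nhds (by positivity : 0 < κ / 4))).mono (fun _ h => le_of_lt h)
  obtain ⟨N0, hN0⟩ := Filter.eventually_atTop.mp hlim
  refine ⟨κ / 2, by positivity, (m + 1) * (C1 * (4 / κ)), by nlinarith,
    N0 + (4 * (m + 1) * r + 1) + (r + (m * b + 1)) + 2 * r, ?_⟩
  intro n hn
  have hlim' := hN0 n (by omega)
  have hn1 : (1 : ℝ) ≤ n := by exact_mod_cast (by omega : 1 ≤ n)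
  have hn0 : (0 : ℝ) < n := by linarith
  classical
  set base : Finset (Finset (Fin n)) := Finset.powersetCard r Finset.univ with hbase
  set Conf : Finset (Finset (Finset (Fin n))) := Finset.univ.filter
    (fun S => S.card = m + 1 ∧ (S.sup id).card ≤ r + (m * b + 1)) with hConf
  set Bad : Finset (Finset (Finset (Fin n))) := Finset.univ.filter
    (fun T => (∀ A ∈ T, A.card = r) ∧ 2 ≤ T.card ∧ T.card ≤ 4 * (m + 1) ∧ phi m b r T < 0) with hBad
  have hB : ∀ T ∈ Bad, (∀ A ∈ T, A.card = r) ∧ 2 ≤ T.card ∧ T.card ≤ 4 * (m + 1) ∧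
      phi m b r T < 0 := fun T hT => (Finset.mem_filter.mp hT).2
  have hC : ∀ S ∈ Conf, S.card = m + 1 ∧ (S.sup id).card ≤ r + (m * b + 1) :=
    fun S hS => (Finset.mem_filter.mp hS).2
  have hcs := conf_sum hm (by omega) Conf (fun S hS => (hC S hS).2)
  have hbs := bad_sum hm (by omega) Bad hB
  rw [← hC1] at hcs
  rw [← hC2] at hbs
  set G : ℝ := (n : ℝ) ^ (m * gam m) with hG
  have hG0 : 0 < G := by positivity
  set P : ℝ := (n : ℝ) ^ ex m b with hP
  have hP0 : 0 < P := by positivity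
  have hP1 : P ≤ 1 := by
    apply Real.rpow_le_one_of_one_le_of_nonpos hn1
    unfold ex
    have : 0 < 1 / (m : ℝ) := by positivity
    linarith
  set M : ℝ := (n : ℝ) ^ ((r : ℝ) + ex m b) with hM
  have hM0 : 0 < M := by positivity
  have hMP : M = n ^ r * P := by rw [hM, Real.rpow_add hn0, Real.rpow_natCast]
  obtain ⟨R, hR1, hR2, hR3, hR4⟩ := deletion base Conf Bad m (C1 * (4 / κ) * G) P
    (by positivity) hP0.le hP1 (fun S hS => (hC S hS).1)
    (fun T hT => Finset.card_pos.mp (by have := (hB T hT).2.1; omega))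
  have hRc : ∀ A ∈ R, A.card = r := fun A hA => (Finset.mem_powersetCard.mp (hR1 hA)).2
  refine ⟨R, ⟨hRc, ?_⟩, ?_, ?_⟩
  · intro T hT h1 h2
    by_contra h3
    push Not at h3
    refine hR2 T ?_ hT
    rw [hBad, Finset.mem_filter]
    exact ⟨Finset.mem_univ _, fun A hA => hRc A (hT hA), h1, h2, h3⟩
  · intro v
    have e : (Finset.univ.filter (fun S : Finset (Finset (Fin n)) => S ⊆ R ∧ S.card = m + 1 ∧
          (S.sup id).card ≤ r + (m * b + 1))) = Conf.filter (fun S => S ⊆ R) := by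
      ext S
      simp only [hConf, Finset.mem_filter, Finset.mem_univ, true_and]
      tauto
    rw [e]
    refine (hR3 v).trans (le_of_eq ?_)
    ring
  · refine le_trans ?_ hR4
    have e1 : κ * M ≤ P * base.card := by
      have h1 := choose_lb (n := n) (r := r) (by omega)
      rw [← hκ] at h1
      have h2 : base.card = n.choose r := by
        rw [hbase, Finset.card_powersetCard, Finset.card_univ, Fintype.card_fin]
      rw [h2, hMP]
      nlinarith
    have e2 : Conf.card * P ^ (m + 1) / (C1 * (4 / κ) * G) ≤ κ / 4 * M := by
      rw [div_le_iff₀ (by positivity)]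
      refine hcs.trans (le_of_eq ?_)
      field_simp
    have e3 : ∑ T ∈ Bad, P ^ T.card ≤ κ / 4 * M := by
      refine hbs.trans ?_
      rw [sub_eq_add_neg, Real.rpow_add hn0, ← hM]
      nlinarith
    linarith

theorem main (m b r : ℕ) (hm : 2 ≤ m) (hb : 1 ≤ b) :
    ∃ c : ℝ, 0 < c ∧ ∃ N : ℕ, ∀ n : ℕ, N ≤ n →
      ∃ H : Finset (Finset (Fin n)), (∀ A ∈ H, A.card = r) ∧
        c * (n : ℝ) ^ ((r : ℝ) - b - 1 / m) * Real.log n ^ ((1 : ℝ) / m) ≤ H.card ∧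
        ∀ S ⊆ H, S.card = m + 1 → r + (m * b + 1) + 1 ≤ (S.sup id).card := by
  have hm0 : (0 : ℝ) < m := by exact_mod_cast (by omega : 0 < m)
  obtain ⟨c, hc, d0, hd0, hak⟩ := akpss m (by omega)
  obtain ⟨κ, hκ, K, hK, N, hN⟩ := sample m b r hm hb
  have hγ := gam_pos hm
  have hlim : ∀ᶠ n : ℕ in Filter.atTop, d0 ≤ (n : ℝ) ^ (m * gam m) :=
    ((tendsto_rpow_atTop (by positivity)).comp
      tendsto_natCast_atTop_atTop).eventually_ge_atTop d0
  obtain ⟨N1, hN1⟩ := Filter.eventually_atTop.mp hlim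
  refine ⟨c * (m * gam m / K) ^ ((1 : ℝ) / m) * κ, by positivity, N + N1 + 1, ?_⟩
  intro n hn
  obtain ⟨R, hR, hdeg, hcard⟩ := hN n (by omega)
  have hG := hN1 n (by omega)
  have hn1 : (1 : ℝ) ≤ n := by exact_mod_cast (by omega : 1 ≤ n)
  have hn0 : (0 : ℝ) < n := by linarith
  set G : ℝ := (n : ℝ) ^ (m * gam m) with hGdef
  have hG0 : 0 < G := by positivity
  set E := (Finset.univ.filter (fun S : Finset (Finset (Fin n)) => S ⊆ R ∧ S.card = m + 1 ∧
          (S.sup id).card ≤ r + (m * b + 1))) with hE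
  have hE' : ∀ S ∈ E, S ⊆ R ∧ S.card = m + 1 ∧ (S.sup id).card ≤ r + (m * b + 1) :=
    fun S hS => (Finset.mem_filter.mp hS).2
  obtain ⟨I, hI1, hI2, hI3⟩ := hak (K * G) (by nlinarith) (Finset (Fin n)) R E
    (fun S hS => (hE' S hS).1) (fun S hS => (hE' S hS).2.1) (girth hm hR E hE') hdeg
  refine ⟨I, fun A hA => hR.card A (hI1 hA), le_trans ?_ hI3, ?_⟩
  · have hlogn : 0 ≤ Real.log n := Real.log_nonneg hn1
    have hlog : m * gam m * Real.log n ≤ Real.log (K * G) := by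
      rw [Real.log_mul (by linarith) hG0.ne', hGdef, Real.log_rpow hn0]
      have := Real.log_nonneg hK
      linarith
    have h1 : (m * gam m / K) ^ ((1 : ℝ) / m) * Real.log n ^ ((1 : ℝ) / m) * (n : ℝ) ^ (-gam m) ≤
        (Real.log (K * G) / (K * G)) ^ ((1 : ℝ) / m) := by
      have e1 : (n : ℝ) ^ (-gam m) = (G⁻¹) ^ ((1 : ℝ) / m) := by
        rw [hGdef, ← Real.rpow_neg hn0.le, ← Real.rpow_mul hn0.le]
        congr 1
        field_simp
      rw [e1, ← Real.mul_rpow (by positivity) hlogn,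
        ← Real.mul_rpow (by positivity) (by positivity)]
      apply Real.rpow_le_rpow (by positivity) _ (by positivity)
      calc m * gam m / K * Real.log n * G⁻¹ = m * gam m * Real.log n / (K * G) := by
            field_simp
        _ ≤ _ := by gcongr
    have e2 : (n : ℝ) ^ ((r : ℝ) - b - 1 / m) = (n : ℝ) ^ (-gam m) * (n : ℝ) ^ ((r : ℝ) + ex m b) := by
      rw [← Real.rpow_add hn0]
      congr 1
      unfold ex
      ring
    rw [e2]
    calc c * (m * gam m / K) ^ ((1 : ℝ) / m) * κ *
          ((n : ℝ) ^ (-gam m) * (n : ℝ) ^ ((r : ℝ) + ex m b)) * Real.log n ^ ((1 : ℝ) / m)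
        = c * ((m * gam m / K) ^ ((1 : ℝ) / m) * Real.log n ^ ((1 : ℝ) / m) *
            (n : ℝ) ^ (-gam m)) * (κ * (n : ℝ) ^ ((r : ℝ) + ex m b)) := by ring
      _ ≤ _ := by
          have hl0 : 0 ≤ Real.log (K * G) := le_trans (by positivity) hlog
          have hl1 : 0 ≤ Real.log (K * G) / (K * G) := div_nonneg hl0 (by positivity)
          have hl2 : 0 ≤ (Real.log (K * G) / (K * G)) ^ ((1 : ℝ) / m) := Real.rpow_nonneg hl1 _
          gcongr
  · intro S hS hSc
    by_contra h
    exact hI2 S (by rw [hE, Finset.mem_filter]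
                    exact ⟨Finset.mem_univ _, hS.trans hI1, hSc, by omega⟩) hS

end BES

/-- For fixed `r > k ≥ 2` and `e ≥ 3`,
`f_r(n, e(r-k)+k+1, e) = Ω(n^(k - 1/(e-1)) (log n)^(1/(e-1)))`. -/
theorem stmt_2 (r k e : ℕ) (hk : 2 ≤ k) (hrk : k < r) (he : 3 ≤ e) :
    ∃ c : ℝ, 0 < c ∧ ∃ N : ℕ, ∀ n : ℕ, N ≤ n →
      ∃ H : Finset (Finset (Fin n)),
        (∀ A ∈ H, A.card = r) ∧
        c * (n : ℝ) ^ ((k : ℝ) - 1 / ((e : ℝ) - 1)) *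
          Real.log n ^ ((1 : ℝ) / ((e : ℝ) - 1)) ≤ H.card ∧
        ∀ S ⊆ H, S.card = e → e * (r - k) + k + 1 + 1 ≤ (S.sup id).card := by
  obtain ⟨m, rfl⟩ : ∃ m, e = m + 1 := ⟨e - 1, by omega⟩
  obtain ⟨b, rfl⟩ : ∃ b, r = k + b := ⟨r - k, by omega⟩
  obtain ⟨c, hc, N, hN⟩ := BES.main m b (k + b) (by omega) (by omega)
  refine ⟨c, hc, N, fun n hn => ?_⟩
  obtain ⟨H, h1, h2, h3⟩ := hN n hn
  refine ⟨H, h1, ?_, ?_⟩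
  · have e1 : ((m + 1 : ℕ) : ℝ) - 1 = m := by push_cast; ring
    have e2 : ((k + b : ℕ) : ℝ) - b - 1 / m = (k : ℝ) - 1 / m := by push_cast; ring
    rw [e2] at h2
    rw [e1]
    exact h2
  · intro S hS hc
    have := h3 S hS hc
    have e3 : (m + 1) * (k + b - k) + k + 1 + 1 = k + b + (m * b + 1) + 1 := by
      rw [Nat.add_sub_cancel_left]; ring
    omega
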